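/- Let k ≥ 1. Every surjective homomorphism φ : F_k →* N_k from the free group of rank k onto the nonorientable genus-k surface group is Nielsen equivalent to the standard epimorphism: there is an automorphism α of F_k with φ ∘ α = ρ_k. -/

import Mathlib

/-- The single relator `x_0² x_1² ⋯ x_{k-1}²` of the nonorientable genus-`k`
surface group, as an element of the free group on `Fin k`. -/
def nonorientableRelator (k : ℕ) : FreeGroup (Fin k) :=
  ((List.finRange k).map (fun i => (FreeGroup.of i) ^ 2)).prod

/-- The nonorientable genus-`k` surface group. -/
def NonorientableSurfaceGroup (k : ℕ) : Type :=
  PresentedGroup ({nonorientableRelator k} : Set (FreeGroup (Fin k)))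

instance (k : ℕ) : Group (NonorientableSurfaceGroup k) :=
  inferInstanceAs (Group (PresentedGroup _))

/-- The standard epimorphism `ρ_k : F_k →* N_k`, the quotient map of the presentation. -/
def standardRho (k : ℕ) : FreeGroup (Fin k) →* NonorientableSurfaceGroup k :=
  PresentedGroup.mk _

namespace NSG

/-! ### Paths in labelled graphs -/

/-- `GPath src tgt ℓ E u w v`: there is a path in the graph with edge set `E` from `u` to `v`
whose label (product of the `ℓ e`) is `w`. -/
inductive GPath {ε V G : Type*} [Group G] (src tgt : ε → V) (ℓ : ε → G) (E : Set ε) :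
    V → G → V → Prop
  | nil (v : V) : GPath src tgt ℓ E v 1 v
  | fwd (e : ε) (he : e ∈ E) {w : G} {z : V} (h : GPath src tgt ℓ E (tgt e) w z) :
      GPath src tgt ℓ E (src e) (ℓ e * w) z
  | bwd (e : ε) (he : e ∈ E) {w : G} {z : V} (h : GPath src tgt ℓ E (src e) w z) :
      GPath src tgt ℓ E (tgt e) ((ℓ e)⁻¹ * w) z

namespace GPath

variable {ε V G : Type*} [Group G] {src tgt : ε → V} {ℓ : ε → G} {E : Set ε}

theorem trans {u v z : V} {a b : G} (h : GPath src tgt ℓ E u a v) (h' : GPath src tgt ℓ E v b z) :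
    GPath src tgt ℓ E u (a * b) z := by
  induction h with
  | nil v => simpa using h'
  | fwd e he h ih => rw [mul_assoc]; exact fwd e he (ih h')
  | bwd e he h ih => rw [mul_assoc]; exact bwd e he (ih h')

theorem single (e : ε) (he : e ∈ E) : GPath src tgt ℓ E (src e) (ℓ e) (tgt e) := by
  simpa using fwd e he (nil (src := src) (ℓ := ℓ) (tgt e))

theorem single_inv (e : ε) (he : e ∈ E) : GPath src tgt ℓ E (tgt e) (ℓ e)⁻¹ (src e) := by
  simpa using bwd e he (nil (tgt := tgt) (ℓ := ℓ) (src e))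

theorem symm {u v : V} {a : G} (h : GPath src tgt ℓ E u a v) : GPath src tgt ℓ E v a⁻¹ u := by
  induction h with
  | nil v => simpa using nil v
  | fwd e he h ih => rw [mul_inv_rev]; exact ih.trans (single_inv e he)
  | bwd e he h ih => rw [mul_inv_rev, inv_inv]; exact ih.trans (single e he)

/-- Substitution of edges by paths, along a map of vertices and a homomorphism of labels. -/
theorem subst {ε' V' G' : Type*} [Group G'] {src' tgt' : ε' → V'} {ℓ' : ε' → G'} {E' : Set ε'}
    (p : V → V') (f : G →* G')
    (H : ∀ e ∈ E, GPath src' tgt' ℓ' E' (p (src e)) (f (ℓ e)) (p (tgt e)))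
    {u v : V} {a : G} (h : GPath src tgt ℓ E u a v) :
    GPath src' tgt' ℓ' E' (p u) (f a) (p v) := by
  induction h with
  | nil v => simpa using nil (p v)
  | fwd e he h ih => rw [map_mul]; exact (H e he).trans ih
  | bwd e he h ih => rw [map_mul, map_inv]; exact (H e he).symm.trans ih

theorem mono {E' : Set ε} (hE : E ⊆ E') {u v : V} {a : G} (h : GPath src tgt ℓ E u a v) :
    GPath src tgt ℓ E' u a v :=
  h.subst id (MonoidHom.id G) (fun e he => single e (hE he))

theorem fix (f : G →* G) (H : ∀ e ∈ E, f (ℓ e) = ℓ e) {u v : V} {a : G}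
    (h : GPath src tgt ℓ E u a v) : f a = a := by
  induction h with
  | nil v => simp
  | fwd e he h ih => rw [map_mul, ih, H e he]
  | bwd e he h ih => rw [map_mul, map_inv, ih, H e he]

theorem lift {G' : Type*} [Group G'] (f : G' →* G) (ℓ' : ε → G') (hf : ∀ e, f (ℓ' e) = ℓ e)
    {u v : V} {a : G} (h : GPath src tgt ℓ E u a v) :
    ∃ b, f b = a ∧ GPath src tgt ℓ' E u b v := by
  induction h with
  | nil v => exact ⟨1, map_one f, nil v⟩
  | fwd e he h ih =>
    obtain ⟨b, hb, hp⟩ := ih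
    exact ⟨ℓ' e * b, by rw [map_mul, hb, hf], fwd e he hp⟩
  | bwd e he h ih =>
    obtain ⟨b, hb, hp⟩ := ih
    exact ⟨(ℓ' e)⁻¹ * b, by rw [map_mul, map_inv, hb, hf], bwd e he hp⟩

/-- Closed paths at a vertex form a subgroup. -/
def loops (src tgt : ε → V) (ℓ : ε → G) (E : Set ε) (v : V) : Subgroup G where
  carrier := {w | GPath src tgt ℓ E v w v}
  one_mem' := nil v
  mul_mem' := fun h h' => h.trans h'
  inv_mem' := fun h => h.symm

theorem mem_loops {v : V} {w : G} : w ∈ loops src tgt ℓ E v ↔ GPath src tgt ℓ E v w v := Iff.rfl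

end GPath

/-! ### Products along sequences -/

/-- `sp f t n = f t * f (t+1) * ⋯ * f (t+n-1)`. -/
def sp {G : Type*} [Group G] (f : ℕ → G) (t : ℕ) : ℕ → G
  | 0 => 1
  | n + 1 => sp f t n * f (t + n)

section sp
variable {G : Type*} [Group G]

theorem sp_add (f : ℕ → G) (t a b : ℕ) : sp f t (a + b) = sp f t a * sp f (t + a) b := by
  induction b with
  | zero => simp [sp]
  | succ b ih => rw [← add_assoc, sp, ih, sp, mul_assoc, add_assoc]

theorem sp_one (f : ℕ → G) (t : ℕ) : sp f t 1 = f t := by simp [sp]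

theorem map_sp {G' : Type*} [Group G'] (φ : G →* G') (f : ℕ → G) (t n : ℕ) :
    φ (sp f t n) = sp (fun m => φ (f m)) t n := by
  induction n with
  | zero => simp [sp]
  | succ b ih => rw [sp, map_mul, ih, sp]

theorem sp_congr {f g : ℕ → G} {t n : ℕ} (h : ∀ m, t ≤ m → m < t + n → f m = g m) :
    sp f t n = sp g t n := by
  induction n with
  | zero => rfl
  | succ n ih =>
    rw [sp, sp, ih (fun m h1 h2 => h m h1 (by omega)), h (t + n) (by omega) (by omega)]

theorem sp_shift {f : ℕ → G} {p : ℕ} (hf : Function.Periodic f p) (n : ℕ) :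
    sp f p n = sp f 0 n := by
  induction n with
  | zero => rfl
  | succ n ih => rw [sp, sp, ih, add_comm p n, hf n, zero_add]

theorem sp_rot {f : ℕ → G} {p : ℕ} (hf : Function.Periodic f p) (t : ℕ) :
    sp f t p = (sp f 0 t)⁻¹ * sp f 0 p * sp f 0 t := by
  have h1 := sp_add f 0 t p
  have h2 := sp_add f 0 p t
  rw [zero_add] at h1 h2
  rw [sp_shift hf, add_comm, h1] at h2
  rw [mul_assoc, ← h2]; group

end sp

theorem GPath.ofSeq {ε V G : Type*} [Group G] {src tgt : ε → V} {ℓ : ε → G} {E : Set ε}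
    (d : ℕ → ε) (c : ℕ → V) (t n : ℕ)
    (h : ∀ m, t ≤ m → m < t + n → d m ∈ E ∧ src (d m) = c m ∧ tgt (d m) = c (m + 1)) :
    GPath src tgt ℓ E (c t) (sp (fun m => ℓ (d m)) t n) (c (t + n)) := by
  induction n with
  | zero => exact GPath.nil _
  | succ n ih =>
    obtain ⟨h1, h2, h3⟩ := h (t + n) (by omega) (by omega)
    have := GPath.single (src := src) (tgt := tgt) (ℓ := ℓ) _ h1
    rw [h2, h3] at this
    exact (ih fun m hm hm' => h m hm (by omega)).trans this

/-! ### Deterministic graphs: unique lifting -/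

section det
variable {ι V : Type} [Finite V]

theorem exists_perm (T : V → V → Prop) (h1 : ∀ u u' v, T u v → T u' v → u = u')
    (h2 : ∀ u v v', T u v → T u v' → v = v') :
    ∃ σ : Equiv.Perm V, ∀ u v, T u v → σ v = u := by
  classical
  have := Fintype.ofFinite V
  let f : V → V := fun v => if h : ∃ u, T u v then h.choose else v
  have hf : ∀ u v, T u v → f v = u := by
    intro u v h
    have h' : ∃ u, T u v := ⟨u, h⟩
    simp only [f, dif_pos h']
    exact h1 _ _ _ h'.choose_spec h
  obtain ⟨g, hg⟩ := Finset.exists_equiv_extend_of_card_eq (α := V) (t := (Finset.univ : Finset V))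
    (by simp) (s := Finset.univ.filter fun v => ∃ u, T u v) (f := f) (by simp) (by
      intro a ha b hb hab
      simp only [Finset.coe_filter, Finset.mem_univ, true_and, Set.mem_setOf_eq] at ha hb
      obtain ⟨u, hu⟩ := ha
      obtain ⟨u', hu'⟩ := hb
      rw [hf _ _ hu, hf _ _ hu'] at hab
      subst hab
      exact h2 _ _ _ hu hu')
  refine ⟨g.trans (Equiv.subtypeUnivEquiv (by simp)), fun u v h => ?_⟩
  rw [← hf u v h, ← hg v (by simpa using ⟨u, h⟩)]
  rfl

/-- determinism of a labelled graph -/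
def Det (E : Set (V × ι × V)) : Prop :=
  (∀ u u' i v, (u, i, v) ∈ E → (u', i, v) ∈ E → u = u') ∧
  (∀ u i v v', (u, i, v) ∈ E → (u, i, v') ∈ E → v = v')

theorem exists_action {E : Set (V × ι × V)} (hE : Det E) {G : Type*} [Group G]
    (a : V × ι × V → G) :
    ∃ Θ : FreeGroup ι →* Equiv.Perm (V × G), ∀ u (x : FreeGroup ι × G) v,
      GPath (fun e : V × ι × V => e.1) (fun e => e.2.2) (fun e => (FreeGroup.of e.2.1, a e)) E u x v →
      ∀ γ, Θ x.1 (v, γ) = (u, x.2 * γ) := by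
  classical
  have hσ : ∀ i : ι, ∃ σ : Equiv.Perm V, ∀ u v, (u, i, v) ∈ E → σ v = u := fun i =>
    exists_perm (fun u v => (u, i, v) ∈ E) (fun u u' v => hE.1 u u' i v) (fun u v v' => hE.2 u i v v')
  choose σ hσ using hσ
  let b : ι → V → G := fun i z => if (σ i z, i, z) ∈ E then a (σ i z, i, z) else 1
  let Θ : FreeGroup ι →* Equiv.Perm (V × G) :=
    FreeGroup.lift fun i => Equiv.prodShear (σ i) (fun z => Equiv.mulLeft (b i z))
  have key : ∀ e ∈ E, ∀ γ, Θ (FreeGroup.of e.2.1) (e.2.2, γ) = (e.1, a e * γ) := by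
    rintro ⟨u, i, v⟩ he γ
    have h := hσ i u v he
    simp only [Θ, FreeGroup.lift_apply_of, Equiv.prodShear_apply, Equiv.coe_mulLeft, b, h, he, if_true]
  refine ⟨Θ, fun u x v h => ?_⟩
  induction h with
  | nil v => intro γ; simp
  | fwd e he h ih =>
    intro γ
    simp only [Prod.fst_mul, Prod.snd_mul, map_mul, Equiv.Perm.mul_apply]
    rw [ih, key e he, mul_assoc]
  | bwd e he h ih =>
    intro γ
    simp only [Prod.fst_mul, Prod.snd_mul, map_mul, Equiv.Perm.mul_apply, Prod.fst_inv, Prod.snd_inv,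
      map_inv]
    rw [ih, Equiv.Perm.inv_def, Equiv.symm_apply_eq, key e he]
    simp [mul_assoc]

end det

/-! ### Balls in free groups, and the Hopf property -/

section ball
variable {ι : Type}

/-- The ball of radius `N` in a free group. -/
abbrev Ball (ι : Type) [DecidableEq ι] (N : ℕ) : Type := {b : FreeGroup ι // b.norm ≤ N}

variable [DecidableEq ι]

theorem ball_finite [Finite ι] (N : ℕ) : Finite (Ball ι N) := by
  have h := List.finite_length_le (ι × Bool) N
  have : Finite {l : List (ι × Bool) | l.length ≤ N} := h
  refine Finite.of_injective
    (fun b : Ball ι N => (⟨b.1.toWord, b.2⟩ : {l : List (ι × Bool) | l.length ≤ N})) ?_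
  intro a b hab
  have h2 := congrArg Subtype.val hab
  exact Subtype.ext (FreeGroup.toWord_injective h2)

abbrev LP {ι V : Type} (E : Set (V × ι × V)) (u : V) (w : FreeGroup ι) (v : V) : Prop :=
  GPath (fun e : V × ι × V => e.1) (fun e => e.2.2) (fun e => FreeGroup.of e.2.1) E u w v

theorem ball_path {N : ℕ} {E : Set (Ball ι N × ι × Ball ι N)}
    (hE : ∀ (b b' : Ball ι N) i, b'.1 = b.1 * FreeGroup.of i → (b, i, b') ∈ E) :
    ∀ (l : List (ι × Bool)) (_ : l.length ≤ N) (b0 b : Ball ι N), b0.1 = 1 → b.1 = FreeGroup.mk l →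
      LP E b0 (FreeGroup.mk l) b := by
  intro l
  induction l using List.reverseRecOn with
  | nil =>
    intro _ b0 b h0 hb
    have : b = b0 := Subtype.ext (by rw [hb, h0, FreeGroup.one_eq_mk])
    subst this
    rw [← FreeGroup.one_eq_mk]
    exact GPath.nil _
  | append_singleton l x ih =>
    intro hl b0 b h0 hb
    rw [List.length_append, List.length_singleton] at hl
    let b1 : Ball ι N := ⟨FreeGroup.mk l, FreeGroup.norm_mk_le.trans (by omega)⟩
    have h1 := ih (by omega) b0 b1 h0 rfl
    rw [← FreeGroup.mul_mk] at hb ⊢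
    refine h1.trans ?_
    obtain ⟨i, _ | _⟩ := x
    · have e1 : (FreeGroup.mk [(i, false)]) = (FreeGroup.of i)⁻¹ := by
        simp [FreeGroup.of, FreeGroup.inv_mk, FreeGroup.invRev]
      rw [e1] at hb ⊢
      exact GPath.single_inv (src := fun e : Ball ι N × ι × Ball ι N => e.1)
        (tgt := fun e => e.2.2) (ℓ := fun e => FreeGroup.of e.2.1) (b, i, b1) (hE _ _ _ (by
          rw [hb]; simp [b1]))
    · exact GPath.single (src := fun e : Ball ι N × ι × Ball ι N => e.1)
        (tgt := fun e => e.2.2) (ℓ := fun e => FreeGroup.of e.2.1) (b1, i, b) (hE _ _ _ hb)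

theorem ball_path' {N : ℕ} {E : Set (Ball ι N × ι × Ball ι N)}
    (hE : ∀ (b b' : Ball ι N) i, b'.1 = b.1 * FreeGroup.of i → (b, i, b') ∈ E)
    (b0 b : Ball ι N) (h0 : b0.1 = 1) : LP E b0 b.1 b := by
  have := ball_path hE b.1.toWord b.2 b0 b h0 FreeGroup.mk_toWord.symm
  rwa [FreeGroup.mk_toWord] at this

theorem resid_finite [Finite ι] (w : FreeGroup ι) (hw : w ≠ 1) :
    ∃ (Q : Type) (_ : Group Q) (_ : Finite Q) (θ : FreeGroup ι →* Q), θ w ≠ 1 := by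
  let N := w.norm
  have := ball_finite (ι := ι) N
  let E : Set (Ball ι N × ι × Ball ι N) := {e | e.2.2.1 = e.1.1 * FreeGroup.of e.2.1}
  have hE : Det E := by
    constructor
    · intro u u' i v h h'
      have h1 : v.1 = u.1 * FreeGroup.of i := h
      have h2 : v.1 = u'.1 * FreeGroup.of i := h'
      exact Subtype.ext (mul_right_cancel (h1.symm.trans h2))
    · intro u i v v' h h'
      have h1 : v.1 = u.1 * FreeGroup.of i := h
      have h2 : v'.1 = u.1 * FreeGroup.of i := h'
      exact Subtype.ext (h1.trans h2.symm)
  obtain ⟨Θ, hΘ⟩ := exists_action hE (G := PUnit.{1}) (fun _ => 1)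
  have hp := ball_path' (E := E) (fun b b' i h => h) ⟨1, by simp⟩ ⟨w, le_refl _⟩ rfl
  obtain ⟨b, hb, hb'⟩ := hp.lift (MonoidHom.fst (FreeGroup ι) PUnit.{1})
    (fun e : Ball ι N × ι × Ball ι N => (FreeGroup.of e.2.1, 1)) (fun e => rfl)
  have h3 := hΘ _ _ _ hb' 1
  refine ⟨Equiv.Perm (Ball ι N × PUnit.{1}), inferInstance, inferInstance, Θ, fun h => hw ?_⟩
  rw [MonoidHom.coe_fst] at hb
  rw [hb] at h3
  simp only [] at h3
  rw [h] at h3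
  have := congrArg (fun x => x.1.1) h3
  simpa using this

theorem hopf [Finite ι] (μ : FreeGroup ι →* FreeGroup ι) (hμ : Function.Surjective μ) :
    Function.Injective μ := by
  rw [injective_iff_map_eq_one]
  intro w hw
  by_contra hne
  obtain ⟨Q, _, _, θ, hθ⟩ := resid_finite w hne
  have hfin : Finite (FreeGroup ι →* Q) := Finite.of_equiv _ (FreeGroup.lift (α := ι) (β := Q))
  have hinj : Function.Injective (fun f : FreeGroup ι →* Q => f.comp μ) := by
    intro f g hfg
    ext i
    obtain ⟨y, hy⟩ := hμ (FreeGroup.of i)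
    have := DFunLike.congr_fun hfg y
    simpa [hy] using this
  obtain ⟨θ', h⟩ := Finite.surjective_of_injective hinj θ
  apply hθ
  rw [← h]
  simp [hw]

end ball

/-! ### The relator as a periodic word -/

section lab
variable (k : ℕ) [NeZero k]

/-- the label of the `n`-th edge of the boundary of the relator cell -/
def lab (n : ℕ) : Fin k := ⟨(n / 2) % k, Nat.mod_lt _ (Nat.pos_of_ne_zero (NeZero.ne k))⟩

/-- the other position with the same label -/
def bar (n : ℕ) : ℕ := if n % 2 = 0 then n + 1 else n - 1

theorem bar_bar (n : ℕ) : bar (bar n) = n := by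
  unfold bar; split_ifs <;> omega

theorem bar_lt {n k : ℕ} (h : n < 2 * k) : bar n < 2 * k := by
  unfold bar; split_ifs <;> omega

theorem bar_ne (n : ℕ) : bar n ≠ n := by
  unfold bar; split_ifs <;> omega

theorem lab_bar (n : ℕ) : lab k (bar n) = lab k n := by
  have : bar n / 2 = n / 2 := by unfold bar; split_ifs <;> omega
  simp [lab, this]

theorem lab_periodic : Function.Periodic (lab k) (2 * k) := by
  intro n
  have : (n + 2 * k) / 2 = n / 2 + k := by omega
  simp [lab, this]

theorem lab_mod (n : ℕ) : lab k (n % (2 * k)) = lab k n := (lab_periodic k).map_mod_nat n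

theorem lab_eq_lt {n n' : ℕ} (hn : n < 2 * k) (hn' : n' < 2 * k) (h : lab k n' = lab k n) :
    n' = n ∨ n' = bar n := by
  have h1 : (n' / 2) % k = (n / 2) % k := congrArg Fin.val h
  rw [Nat.mod_eq_of_lt (by omega), Nat.mod_eq_of_lt (by omega)] at h1
  unfold bar; split_ifs <;> omega

theorem two_k_pos : 0 < 2 * k := by
  have := Nat.pos_of_ne_zero (NeZero.ne k); omega

/-- letters of the relator -/
def X (n : ℕ) : FreeGroup (Fin k) := FreeGroup.of (lab k n)

theorem X_periodic : Function.Periodic (X k) (2 * k) := fun n => by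
  simp only [X, lab_periodic k n]

theorem relator_eq : sp (X k) 0 (2 * k) = nonorientableRelator k := by
  have h : ∀ m, sp (X k) 0 (2 * m) = ((List.range m).map (fun j => (X k (2 * j)) ^ 2)).prod := by
    intro m
    induction m with
    | zero => rfl
    | succ m ih =>
      rw [List.range_succ, List.map_append, List.prod_append, ← ih, mul_add, mul_one, sp, sp]
      simp only [zero_add, List.map_cons, List.map_nil, List.prod_cons, List.prod_nil, mul_one]
      have : X k (2 * m + 1) = X k (2 * m) := by
        have h1 : (2 * m + 1) / 2 = 2 * m / 2 := by omega
        simp [X, lab, h1]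
      rw [this, sq, mul_assoc]
  rw [h, nonorientableRelator, ← List.map_coe_finRange_eq_range, List.map_map]
  congr 1
  apply List.map_congr_left
  intro i _
  have : lab k (2 * i.1) = i := by
    apply Fin.ext
    simp [lab, Nat.mod_eq_of_lt i.2]
  simp [X, this]

theorem rho_relator : standardRho k (nonorientableRelator k) = 1 :=
  (PresentedGroup.mk_eq_one_iff (rels := {nonorientableRelator k})).2
    (Subgroup.subset_normalClosure rfl)

theorem rho_eq_one (w : FreeGroup (Fin k)) (h : standardRho k w = 1) :
    w ∈ Subgroup.normalClosure {nonorientableRelator k} :=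
  (PresentedGroup.mk_eq_one_iff (rels := {nonorientableRelator k})).1 h

theorem rho_surj : Function.Surjective (standardRho k) :=
  PresentedGroup.mk_surjective {nonorientableRelator k}

theorem rho_sp (t : ℕ) : standardRho k (sp (X k) t (2 * k)) = 1 := by
  rw [sp_rot (X_periodic k), relator_eq]
  simp [rho_relator]

end lab


/-! ### States and the collapse lemma -/

section state
variable {k : ℕ} [NeZero k]

/-- A folding state: a labelled graph whose loops at the base point are generated by a lift
of `φ` together with the closed relator cells, and an almost closed relator cell. -/
structure St (φ : FreeGroup (Fin k) →* NonorientableSurfaceGroup k) (V : Type) where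
  E : Set (V × Fin k × V)
  v0 : V
  conn : ∀ v, ∃ w, LP E v0 w v
  μ : FreeGroup (Fin k) →* FreeGroup (Fin k)
  hμ : ∀ x, standardRho k (μ x) = φ x
  hr : ∀ x, LP E v0 (μ x) v0
  gen : ∀ w, LP E v0 w v0 → w ∈ Subgroup.closure (Set.range μ ∪
    {y | ∃ (c : ℕ → V) (t : ℕ) (h : FreeGroup (Fin k)), Function.Periodic c (2 * k) ∧
      (∀ n, (c n, lab k n, c (n + 1)) ∈ E) ∧ LP E v0 h (c t) ∧
      y = h * sp (X k) t (2 * k) * h⁻¹})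
  proper : ∃ w, ¬ LP E v0 w v0
  c : ℕ → V
  s : ℕ
  hc : Function.Periodic c (2 * k)
  hcE : ∀ n, n % (2 * k) ≠ s % (2 * k) → (c n, lab k n, c (n + 1)) ∈ E
  full : ∀ w, LP (insert (c s, lab k s, c (s + 1)) E) v0 w v0

/-- The goal: `φ` lifts to an epimorphism of free groups. -/
def Goal (φ : FreeGroup (Fin k) →* NonorientableSurfaceGroup k) : Prop :=
  ∃ μ : FreeGroup (Fin k) →* FreeGroup (Fin k), Function.Surjective μ ∧
    ∀ x, standardRho k (μ x) = φ x

theorem mod_ne {n j p : ℕ} (h1 : n < j) (h2 : j < n + p) : j % p ≠ n % p := by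
  intro h
  obtain ⟨i, rfl⟩ := Nat.exists_eq_add_of_lt h1
  have h3 : n + (i + 1) ≡ n + 0 [MOD p] := h
  have h4 := Nat.ModEq.add_left_cancel' n h3
  have h5 := Nat.le_of_dvd (by omega) ((Nat.modEq_zero_iff_dvd).1 h4)
  omega

/-- paths in the image graph -/
theorem image_path {ε W : Type} (src tgt : ε → W) (lb : ε → Fin k) (E : Set ε) (u v : W)
    (w : FreeGroup (Fin k)) :
    LP ((fun e => (src e, lb e, tgt e)) '' E) u w v ↔
      GPath src tgt (fun e => FreeGroup.of (lb e)) E u w v := by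
  constructor
  · intro h
    refine h.subst id (MonoidHom.id _) ?_
    rintro _ ⟨e, he, rfl⟩
    exact GPath.single (src := src) (tgt := tgt) (ℓ := fun e => FreeGroup.of (lb e)) e he
  · intro h
    refine h.subst id (MonoidHom.id _) ?_
    intro e he
    exact GPath.single (src := fun e : W × Fin k × W => e.1) (tgt := fun e => e.2.2)
      (ℓ := fun e => FreeGroup.of e.2.1) (src e, lb e, tgt e) ⟨e, he, rfl⟩

variable {φ : FreeGroup (Fin k) →* NonorientableSurfaceGroup k}

theorem collapse {ε W ζ : Type} (src tgt : ε → W) (lb : ε → Fin k) (v0 : W) (d : ζ → ℕ → ε)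
    (hd : ∀ z, Function.Periodic (d z) (2 * k)) (hlb : ∀ z n, lb (d z n) = lab k n)
    (hcl : ∀ z n, tgt (d z n) = src (d z (n + 1)))
    (hfree : ∀ Y : Finset ζ, Y.Nonempty → ∃ z ∈ Y, ∃ n, ∀ z' ∈ Y, ∀ n', d z' n' = d z n →
      z' = z ∧ n' % (2 * k) = n % (2 * k)) (Z : Finset ζ) :
    ∀ (E : Set ε) (M : FreeGroup (Fin k) →* FreeGroup ε),
      (∀ z ∈ Z, ∀ n, d z n ∈ E) →
      (∀ v, ∃ w, GPath src tgt FreeGroup.of E v0 w v) →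
      (∀ x, GPath src tgt FreeGroup.of E v0 (M x) v0) →
      (∀ x, standardRho k (FreeGroup.map lb (M x)) = φ x) →
      (∀ w, GPath src tgt FreeGroup.of E v0 w v0 → w ∈ Subgroup.closure (Set.range M ∪
        {y | ∃ z ∈ Z, ∃ (t : ℕ) (h : FreeGroup ε), GPath src tgt FreeGroup.of E v0 h (src (d z t)) ∧
          y = h * sp (fun m => FreeGroup.of (d z m)) t (2 * k) * h⁻¹})) →
      (∀ w, GPath src tgt (fun e => FreeGroup.of (lb e)) E v0 w v0) →
      Goal φ ∨ Nonempty (St φ W) := by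
  classical
  have hk := two_k_pos k
  induction Z using Finset.strongInduction with
  | H Z IH =>
  intro E M hZE conn hM hρ gen full
  rcases Z.eq_empty_or_nonempty with rfl | hne
  · left
    refine ⟨(FreeGroup.map lb).comp M, fun w => ?_, hρ⟩
    obtain ⟨b, hb, hp⟩ := (full w).lift (FreeGroup.map lb) FreeGroup.of (fun e => FreeGroup.map.of)
    have h1 := gen b hp
    have h2 : (Set.range M ∪ {y | ∃ z ∈ (∅ : Finset ζ), ∃ (t : ℕ) (h : FreeGroup ε),
        GPath src tgt FreeGroup.of E v0 h (src (d z t)) ∧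
          y = h * sp (fun m => FreeGroup.of (d z m)) t (2 * k) * h⁻¹}) = (M.range : Set _) := by
      ext y; simp
    rw [h2, Subgroup.closure_eq] at h1
    obtain ⟨x, hx⟩ := h1
    exact ⟨x, by simp [hx, hb]⟩
  obtain ⟨z, hz, n, hzn⟩ := hfree Z hne
  set g := d z n with hg
  set E' : Set ε := E \ {g} with hE'
  set f : ℕ → FreeGroup ε := fun m => FreeGroup.of (d z m) with hf
  have hfp : Function.Periodic f (2 * k) := fun m => by simp only [hf, hd z m]
  set P := sp f (n + 1) (2 * k - 1) with hP
  let κ : FreeGroup ε →* FreeGroup ε :=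
    FreeGroup.lift fun e => if e = g then P⁻¹ else FreeGroup.of e
  have κg : κ (FreeGroup.of g) = P⁻¹ := by simp [κ]
  have κe : ∀ e, e ≠ g → κ (FreeGroup.of e) = FreeGroup.of e := by
    intro e he; simp [κ, he]
  have hPp : GPath src tgt FreeGroup.of E' (tgt g) P (src g) := by
    have := GPath.ofSeq (src := src) (tgt := tgt) (ℓ := FreeGroup.of) (E := E') (d z)
      (fun m => src (d z m)) (n + 1) (2 * k - 1) (fun m h1 h2 => ⟨⟨hZE z hz m, fun h => ?_⟩,
        rfl, hcl z m⟩)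
    · have e1 : n + 1 + (2 * k - 1) = n + 2 * k := by omega
      simp only [e1, hd z n] at this
      rw [hcl z n]
      exact this
    · exact mod_ne (by omega) (by omega) (hzn z hz m h).2
  have Hκ : ∀ e ∈ E, GPath src tgt FreeGroup.of E' (src e) (κ (FreeGroup.of e)) (tgt e) := by
    intro e he
    by_cases h : e = g
    · subst h; rw [κg]; exact hPp.symm
    · rw [κe e h]; exact GPath.single e ⟨he, h⟩
  have Hκ' : ∀ {u v w}, GPath src tgt FreeGroup.of E u w v → GPath src tgt FreeGroup.of E' u (κ w) v :=
    fun h => h.subst id κ Hκ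
  have κfix : ∀ {u v w}, GPath src tgt FreeGroup.of E' u w v → κ w = w :=
    fun h => h.fix κ (fun e he => κe e he.2)
  have κcell : ∀ z' ∈ Z, z' ≠ z → ∀ t, κ (sp (fun m => FreeGroup.of (d z' m)) t (2 * k)) =
      sp (fun m => FreeGroup.of (d z' m)) t (2 * k) := by
    intro z' hz' hne t
    rw [map_sp]
    apply sp_congr
    intro m _ _
    exact κe _ fun h => hne (hzn z' hz' m h).1
  have spn : sp f n (2 * k) = f n * P := by
    have e1 : 2 * k = 1 + (2 * k - 1) := by omega
    rw [e1, sp_add, sp_one]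
  have κz : ∀ t, κ (sp f t (2 * k)) = 1 := by
    have h1 : κ (sp f n (2 * k)) = 1 := by
      rw [spn, map_mul, κfix hPp]
      show κ (FreeGroup.of g) * P = 1
      rw [κg]; simp
    have h2 : κ (sp f 0 (2 * k)) = 1 := by
      rw [sp_rot hfp n] at h1
      simp only [map_mul, map_inv] at h1
      rw [mul_assoc, inv_mul_eq_one] at h1
      simpa using h1.symm
    intro t
    rw [sp_rot hfp t]
    simp [h2]
  have lbsp : ∀ z' t m, FreeGroup.map lb (sp (fun m => FreeGroup.of (d z' m)) t m) = sp (X k) t m := by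
    intro z' t m
    rw [map_sp]
    apply sp_congr
    intro m _ _
    simp [X, hlb]
  have ρκ : ∀ w, standardRho k (FreeGroup.map lb (κ w)) = standardRho k (FreeGroup.map lb w) := by
    have : ((standardRho k).comp (FreeGroup.map lb)).comp κ = (standardRho k).comp (FreeGroup.map lb) := by
      ext e
      by_cases h : e = g
      · subst h
        have h1 : standardRho k (FreeGroup.map lb (sp f n (2 * k))) = 1 := by
          rw [lbsp, rho_sp]
        rw [spn, map_mul, map_mul] at h1
        simp only [MonoidHom.comp_apply]
        rw [κg, map_inv, map_inv]
        exact (eq_inv_of_mul_eq_one_left h1).symm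
      · simp only [MonoidHom.comp_apply, κe e h]
    exact fun w => DFunLike.congr_fun this w
  have hsub : E' ⊆ E := Set.sdiff_subset
  have gen' : ∀ w, GPath src tgt FreeGroup.of E' v0 w v0 →
      w ∈ Subgroup.closure (Set.range (κ.comp M) ∪
        {y | ∃ z' ∈ Z.erase z, ∃ (t : ℕ) (h : FreeGroup ε),
          GPath src tgt FreeGroup.of E' v0 h (src (d z' t)) ∧
          y = h * sp (fun m => FreeGroup.of (d z' m)) t (2 * k) * h⁻¹}) := by
    intro w hw
    have h1 := gen w (hw.mono hsub)
    rw [← κfix hw]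
    rw [← Subgroup.mem_comap]
    refine (Subgroup.closure_le _).2 ?_ h1
    rintro y (⟨x, rfl⟩ | ⟨z', hz', t, h, hp, rfl⟩)
    · exact Subgroup.subset_closure (Or.inl ⟨x, rfl⟩)
    · by_cases hzz : z' = z
      · subst hzz
        have : κ (h * sp f t (2 * k) * h⁻¹) = 1 := by simp [κz]
        simp only [SetLike.mem_coe, Subgroup.mem_comap]
        rw [this]
        exact one_mem _
      · apply Subgroup.subset_closure
        refine Or.inr ⟨z', Finset.mem_erase.2 ⟨hzz, hz'⟩, t, κ h, Hκ' hp, ?_⟩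
        simp only [map_mul, map_inv, κcell z' hz' hzz]
  have conn' : ∀ v, ∃ w, GPath src tgt FreeGroup.of E' v0 w v := fun v => by
    obtain ⟨w, hw⟩ := conn v
    exact ⟨_, Hκ' hw⟩
  have hZE' : ∀ z' ∈ Z.erase z, ∀ n, d z' n ∈ E' := by
    intro z' hz' m
    obtain ⟨h1, h2⟩ := Finset.mem_erase.1 hz'
    exact ⟨hZE z' h2 m, fun h => h1 (hzn z' h2 m h).1⟩
  by_cases full' : ∀ w, GPath src tgt (fun e => FreeGroup.of (lb e)) E' v0 w v0
  · refine IH (Z.erase z) (Finset.erase_ssubset hz) E' (κ.comp M) hZE' conn'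
      (fun x => Hκ' (hM x)) (fun x => ?_) gen' full'
    rw [MonoidHom.comp_apply, ρκ, hρ]
  · right
    push Not at full'
    have toLP : ∀ {u v w}, GPath src tgt FreeGroup.of E' u w v →
        LP ((fun e => (src e, lb e, tgt e)) '' E') u (FreeGroup.map lb w) v := by
      intro u v w h
      rw [image_path]
      exact h.subst id (FreeGroup.map lb) (fun e he => by
        rw [FreeGroup.map.of]
        exact GPath.single (ℓ := fun e => FreeGroup.of (lb e)) e he)
    refine ⟨St.mk ((fun e => (src e, lb e, tgt e)) '' E') v0 ?_
      ((FreeGroup.map lb).comp (κ.comp M)) ?_ ?_ ?_ ?_ (fun m => src (d z m)) n ?_ ?_ ?_⟩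
    · intro v
      obtain ⟨w, hw⟩ := conn' v
      exact ⟨_, toLP hw⟩
    · intro x
      simp only [MonoidHom.comp_apply]
      rw [ρκ, hρ]
    · intro x
      exact toLP (Hκ' (hM x))
    · intro w hw
      rw [image_path] at hw
      obtain ⟨b, rfl, hp⟩ := hw.lift (FreeGroup.map lb) FreeGroup.of (fun e => FreeGroup.map.of)
      rw [← Subgroup.mem_comap]
      refine (Subgroup.closure_le _).2 ?_ (gen' b hp)
      rintro y (⟨x, rfl⟩ | ⟨z', hz', t, h, hp, rfl⟩)
      · exact Subgroup.subset_closure (Or.inl ⟨x, rfl⟩)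
      · apply Subgroup.subset_closure
        refine Or.inr ⟨fun m => src (d z' m), t, FreeGroup.map lb h, fun m => by
          simp only [hd z' m], fun m => ⟨d z' m, hZE' z' hz' m, ?_⟩, toLP hp, ?_⟩
        · simp only [hlb, hcl]
        · simp only [map_mul, map_inv, lbsp]
    · obtain ⟨w, hw⟩ := full'
      exact ⟨w, fun h => hw ((image_path _ _ _ _ _ _ _).1 h)⟩
    · intro m; simp only [hd z m]
    · intro m hm
      refine ⟨d z m, ⟨hZE z hz m, fun h => hm (hzn z hz m h).2⟩, ?_⟩
      simp only [hlb, hcl]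
    · intro w
      have h1 := (image_path _ _ _ _ _ _ _).2 (full w)
      refine GPath.mono ?_ h1
      rintro _ ⟨e, he, rfl⟩
      by_cases h : e = g
      · left
        rw [h, hg]
        simp only [hlb, hcl]
      · exact Or.inr ⟨e, ⟨he, h⟩, rfl⟩

end state


/-! ### Making a state deterministic -/

section quot
variable {k : ℕ} [NeZero k] {φ : FreeGroup (Fin k) →* NonorientableSurfaceGroup k}

theorem LP.single {ι V : Type} {E : Set (V × ι × V)} {u : V} {i : ι} {v : V} (h : (u, i, v) ∈ E) :
    LP E u (FreeGroup.of i) v :=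
  GPath.single (src := fun e : V × ι × V => e.1) (tgt := fun e => e.2.2)
      (ℓ := fun e => FreeGroup.of e.2.1) (u, i, v) h

theorem LP.subst' {ι V W : Type} {E : Set (V × ι × V)} {E' : Set (W × ι × W)} (π : V → W)
    (H : ∀ u i v, (u, i, v) ∈ E → (π u, i, π v) ∈ E') {u v : V} {w : FreeGroup ι}
    (h : LP E u w v) : LP E' (π u) w (π v) :=
  h.subst π (MonoidHom.id _) (fun e he => LP.single (H _ _ _ he))

theorem St.exists_det {V : Type} [Finite V] (S : St φ V) :
    ∃ (W : Type) (_ : Finite W) (_ : Nat.card W ≤ Nat.card V) (S' : St φ W), Det S'.E := by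
  let R : Setoid V := ⟨fun a b => LP S.E a 1 b, fun a => GPath.nil a,
    fun h => by simpa using h.symm, fun h h' => by simpa using h.trans h'⟩
  let π : V → Quotient R := Quotient.mk R
  have hπ : ∀ {u v}, π u = π v → LP S.E u 1 v := fun h => Quotient.exact h
  have hπ' : ∀ {u v}, LP S.E u 1 v → π u = π v := fun h => Quotient.sound h
  let E' : Set (Quotient R × Fin k × Quotient R) := (fun e => (π e.1, e.2.1, π e.2.2)) '' S.E
  have hE' : ∀ u i v, (u, i, v) ∈ S.E → (π u, i, π v) ∈ E' := fun u i v h => ⟨_, h, rfl⟩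
  have up : ∀ {u w v}, LP S.E u w v → LP E' (π u) w (π v) := fun h => LP.subst' π hE' h
  have down' : ∀ {x w y}, LP E' x w y → ∀ u v, π u = x → π v = y → LP S.E u w v := by
    intro x w y h
    induction h with
    | nil z => intro u v hu hv; exact hπ (hu.trans hv.symm)
    | fwd e he h ih =>
      obtain ⟨⟨a, i, b⟩, hab, rfl⟩ := he
      intro u v hu hv
      have h1 := (hπ hu).trans ((LP.single hab).trans (ih b v rfl hv))
      simpa using h1
    | bwd e he h ih =>
      obtain ⟨⟨a, i, b⟩, hab, rfl⟩ := he
      intro u v hu hv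
      have h1 := (hπ hu).trans ((LP.single hab).symm.trans (ih a v rfl hv))
      simpa using h1
  have down : ∀ {u w v}, LP E' (π u) w (π v) → LP S.E u w v := fun h => down' h _ _ rfl rfl
  have hsurj : Function.Surjective π := Quotient.mk_surjective
  have red : ∀ x y, LP E' x 1 y → x = y := by
    intro x y h
    obtain ⟨u, rfl⟩ := hsurj x
    obtain ⟨v, rfl⟩ := hsurj y
    exact hπ' (down h)
  refine ⟨Quotient R, inferInstance, Nat.card_le_card_of_surjective π hsurj,
    St.mk E' (π S.v0) ?_ S.μ S.hμ (fun x => up (S.hr x)) ?_ ?_ (fun n => π (S.c n)) S.s ?_ ?_ ?_,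
    ?_, ?_⟩
  · intro x
    obtain ⟨v, rfl⟩ := hsurj x
    obtain ⟨w, hw⟩ := S.conn v
    exact ⟨w, up hw⟩
  · intro w hw
    refine Subgroup.closure_mono ?_ (S.gen w (down hw))
    apply Set.union_subset_union_right
    rintro y ⟨c, t, h, hc, hcE, hp, rfl⟩
    exact ⟨fun n => π (c n), t, h, fun n => by simp only [hc n], fun n => hE' _ _ _ (hcE n),
      up hp, rfl⟩
  · obtain ⟨w, hw⟩ := S.proper
    exact ⟨w, fun h => hw (down h)⟩
  · intro n; simp only [S.hc n]
  · intro n hn; exact hE' _ _ _ (S.hcE n hn)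
  · intro w
    refine LP.subst' π ?_ (S.full w)
    rintro u i v (h | h)
    · simp only [Prod.mk.injEq] at h
      obtain ⟨rfl, rfl, rfl⟩ := h
      exact Or.inl rfl
    · exact Or.inr (hE' _ _ _ h)
  · intro u u' i v h h'
    apply red
    simpa using (LP.single h).trans (LP.single h').symm
  · intro u i v v' h h'
    apply red
    simpa using (LP.single h).symm.trans (LP.single h')

end quot

/-! ### The missing edge cannot be free -/

section casei
variable {k : ℕ} [NeZero k] {φ : FreeGroup (Fin k) →* NonorientableSurfaceGroup k}

theorem St.g_not_mem {V : Type} (S : St φ V) : (S.c S.s, lab k S.s, S.c (S.s + 1)) ∉ S.E := by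
  intro h
  obtain ⟨w, hw⟩ := S.proper
  apply hw
  have := S.full w
  rwa [Set.insert_eq_of_mem h] at this

theorem St.case_i {V : Type} [Finite V] (S : St φ V) (hdet : Det S.E)
    (h1 : ∀ v, (S.c S.s, lab k S.s, v) ∉ S.E) (h2 : ∀ u, (u, lab k S.s, S.c (S.s + 1)) ∉ S.E) :
    False := by
  classical
  have hk := two_k_pos k
  set g : V × Fin k × V := (S.c S.s, lab k S.s, S.c (S.s + 1)) with hg
  have hgE : g ∉ S.E := S.g_not_mem
  have hdet' : Det (insert g S.E) := by
    constructor
    · rintro u u' i v (h | h) (h' | h')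
      · exact congrArg Prod.fst (h.trans h'.symm)
      · simp only [hg, Prod.mk.injEq] at h
        obtain ⟨rfl, rfl, rfl⟩ := h
        exact absurd h' (h2 _)
      · simp only [hg, Prod.mk.injEq] at h'
        obtain ⟨rfl, rfl, rfl⟩ := h'
        exact absurd h (h2 _)
      · exact hdet.1 _ _ _ _ h h'
    · rintro u i v v' (h | h) (h' | h')
      · exact congrArg (fun x => x.2.2) (h.trans h'.symm)
      · simp only [hg, Prod.mk.injEq] at h
        obtain ⟨rfl, rfl, rfl⟩ := h
        exact absurd h' (h1 _)
      · simp only [hg, Prod.mk.injEq] at h'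
        obtain ⟨rfl, rfl, rfl⟩ := h'
        exact absurd h (h1 _)
      · exact hdet.2 _ _ _ _ h h'
  let G := Multiplicative (ZMod 2)
  let ω : G := Multiplicative.ofAdd 1
  let a : V × Fin k × V → G := fun e => if e = g then ω else 1
  obtain ⟨Θ, hΘ⟩ := exists_action hdet' a
  have hloop : ∀ w, ∃ b : G, ∀ γ, Θ w (S.v0, γ) = (S.v0, b * γ) := by
    intro w
    obtain ⟨b, hb, hp⟩ := (S.full w).lift (MonoidHom.fst (FreeGroup (Fin k)) G)
      (fun e : V × Fin k × V => (FreeGroup.of e.2.1, a e)) (fun e => rfl)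
    refine ⟨b.2, fun γ => ?_⟩
    have := hΘ _ _ _ hp γ
    rw [MonoidHom.coe_fst] at hb
    rwa [hb] at this
  have hsq : ∀ b γ : G, b * (b * γ) = γ := by decide
  have hrel : ∀ γ, Θ (nonorientableRelator k) (S.v0, γ) = (S.v0, γ) := by
    let T : Submonoid (FreeGroup (Fin k)) :=
      { carrier := {w | ∀ γ, Θ w (S.v0, γ) = (S.v0, γ)}
        one_mem' := fun γ => by simp
        mul_mem' := fun {x y} hx hy γ => by
          rw [map_mul, Equiv.Perm.mul_apply, hy γ, hx γ] }
    have : nonorientableRelator k ∈ T := by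
      apply Submonoid.list_prod_mem
      intro x hx
      obtain ⟨i, _, rfl⟩ := List.mem_map.1 hx
      intro γ
      obtain ⟨b, hb⟩ := hloop (FreeGroup.of i)
      rw [sq, map_mul, Equiv.Perm.mul_apply, hb, hb, hsq]
    exact this
  have lift1 : ∀ {u w v}, LP S.E u w v → GPath (fun e : V × Fin k × V => e.1) (fun e => e.2.2)
      (fun e => (FreeGroup.of e.2.1, a e)) (insert g S.E) u (w, 1) v := by
    intro u w v h
    refine h.subst id (MonoidHom.inl (FreeGroup (Fin k)) G) (fun e he => ?_)
    have hne : e ≠ g := fun h => hgE (h ▸ he)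
    have h3 : (MonoidHom.inl (FreeGroup (Fin k)) G) (FreeGroup.of e.2.1) =
      (fun e : V × Fin k × V => (FreeGroup.of e.2.1, a e)) e := by simp [a, hne]
    rw [h3]
    exact GPath.single (ℓ := fun e : V × Fin k × V => (FreeGroup.of e.2.1, a e)) e (Or.inr he)
  obtain ⟨y, hy⟩ := S.conn (S.c (S.s + 1))
  have hcell : LP S.E (S.c (S.s + 1)) (sp (X k) (S.s + 1) (2 * k - 1)) (S.c S.s) := by
    have := GPath.ofSeq (src := fun e : V × Fin k × V => e.1) (tgt := fun e => e.2.2)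
      (ℓ := fun e => FreeGroup.of e.2.1) (E := S.E) (fun n => (S.c n, lab k n, S.c (n + 1))) S.c
      (S.s + 1) (2 * k - 1) (fun m h1 h2 => ⟨S.hcE m (mod_ne (by omega) (by omega)), rfl, rfl⟩)
    have e1 : S.s + 1 + (2 * k - 1) = S.s + 2 * k := by omega
    rw [e1, S.hc] at this
    exact this
  have hgp : GPath (fun e : V × Fin k × V => e.1) (fun e => e.2.2)
      (fun e => (FreeGroup.of e.2.1, a e)) (insert g S.E) (S.c S.s) (X k S.s, ω)
      (S.c (S.s + 1)) := by
    have := GPath.single (src := fun e : V × Fin k × V => e.1) (tgt := fun e => e.2.2)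
      (ℓ := fun e : V × Fin k × V => (FreeGroup.of e.2.1, a e)) (E := insert g S.E) g (Or.inl rfl)
    have e9 : a g = ω := by simp [a]
    simp only [e9] at this
    exact this
  have htot := ((lift1 hy).trans ((lift1 hcell).trans hgp)).trans (lift1 hy.symm)
  have h3 := hΘ _ _ _ htot 1
  have e2 : (y, (1 : G)) * ((sp (X k) (S.s + 1) (2 * k - 1), 1) * (X k S.s, ω)) * (y⁻¹, 1)
      = (y * sp (X k) (S.s + 1) (2 * k) * y⁻¹, ω) := by
    have e1 : 2 * k = (2 * k - 1) + 1 := by omega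
    have e3 : S.s + 1 + (2 * k - 1) = S.s + 2 * k := by omega
    have e4 : sp (X k) (S.s + 1) (2 * k) = sp (X k) (S.s + 1) (2 * k - 1) * X k S.s := by
      conv_lhs => rw [e1]
      rw [sp, e3, X_periodic]
    rw [e4]
    simp
  rw [e2] at h3
  simp only [mul_one] at h3
  rw [sp_rot (X_periodic k), relator_eq] at h3
  obtain ⟨q, hq⟩ : ∃ q, q = y * (sp (X k) 0 (S.s + 1))⁻¹ := ⟨_, rfl⟩
  have e5 : y * ((sp (X k) 0 (S.s + 1))⁻¹ * nonorientableRelator k * sp (X k) 0 (S.s + 1)) * y⁻¹ =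
    q * (nonorientableRelator k * q⁻¹) := by rw [hq]; group
  rw [e5] at h3
  obtain ⟨b, hb⟩ := hloop q⁻¹
  have h4 : Θ q (Θ q⁻¹ (S.v0, 1)) = (S.v0, 1) := by
    rw [← Equiv.Perm.mul_apply, ← map_mul]; simp
  rw [map_mul, map_mul, Equiv.Perm.mul_apply, Equiv.Perm.mul_apply, hb, hrel, ← hb, h4] at h3
  have h5 : (1 : G) = ω := congrArg Prod.snd h3
  revert h5
  decide

end casei


/-! ### Cells of a state and the free-edge lemma -/

section merge
variable {k : ℕ} [NeZero k] {φ : FreeGroup (Fin k) →* NonorientableSurfaceGroup k}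
variable {V : Type}

/-- closed relator cells -/
def Cell (S : St φ V) : Type :=
  {x : ℕ → V // Function.Periodic x (2 * k) ∧ ∀ n, (x n, lab k n, x (n + 1)) ∈ S.E}

open Classical in
/-- boundary edges of cells; `none` is the almost closed cell, completed by the edge `e` -/
noncomputable def dd (S : St φ V) (e : V × Fin k × V) : Option (Cell S) → ℕ → V × Fin k × V
  | none, n => if n % (2 * k) = S.s % (2 * k) then e else (S.c n, lab k n, S.c (n + 1))
  | some x, n => (x.1 n, lab k n, x.1 (n + 1))

open Classical in
/-- parity weight of an edge at a vertex -/
noncomputable def wt (y : V) (e : V × Fin k × V) : ZMod 2 :=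
  (if e.1 = y then 1 else 0) + (if e.2.2 = y then 1 else 0)

/-- hypotheses for a fold -/
structure Setup (S : St φ V) (e : V × Fin k × V) : Prop where
  det : Det S.E
  he : e ∈ S.E
  hi : e.2.1 = lab k S.s
  hpq : e.1 = S.c S.s ∨ e.2.2 = S.c (S.s + 1)
  hy : ∃ y, wt y e + wt y (S.c S.s, lab k S.s, S.c (S.s + 1)) = 1

variable {S : St φ V} {e : V × Fin k × V}

theorem per_mod {α : Type*} {f : ℕ → α} {p : ℕ} (hf : Function.Periodic f p) {a b : ℕ}
    (h : a % p = b % p) : f a = f b := by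
  rw [← hf.map_mod_nat a, h, hf.map_mod_nat]

theorem per_succ {α : Type*} {f : ℕ → α} {p : ℕ} (hf : Function.Periodic f p) {a b : ℕ}
    (h : a % p = b % p) : f (a + 1) = f (b + 1) :=
  per_mod hf (Nat.ModEq.add_right 1 h)

theorem Setup.arc (H : Setup S e) (x : Cell S) (m : ℕ) (h1 : S.s + 1 ≤ m) (h2 : m ≤ S.s + 2 * k)
    (hm : S.c m = x.1 m) : False := by
  have hk := two_k_pos k
  have hE : ∀ n, S.s + 1 ≤ n → n < S.s + 2 * k → (S.c n, lab k n, S.c (n + 1)) ∈ S.E :=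
    fun n hn hn' => S.hcE n (mod_ne (by omega) (by omega))
  have fw : ∀ j, m + j ≤ S.s + 2 * k → S.c (m + j) = x.1 (m + j) := by
    intro j
    induction j with
    | zero => intro _; exact hm
    | succ j ih =>
      intro hj
      have h3 := hE (m + j) (by omega) (by omega)
      have h4 := x.2.2 (m + j)
      rw [← ih (by omega)] at h4
      exact H.det.2 _ _ _ _ h3 h4
  have bw : ∀ j, S.s + 1 + j ≤ m → S.c (m - j) = x.1 (m - j) := by
    intro j
    induction j with
    | zero => intro _; exact hm
    | succ j ih =>
      intro hj
      have h3 := hE (m - (j + 1)) (by omega) (by omega)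
      have h4 := x.2.2 (m - (j + 1))
      have e1 : m - (j + 1) + 1 = m - j := by omega
      rw [e1] at h3 h4
      rw [← ih (by omega)] at h4
      exact H.det.1 _ _ _ _ h3 h4
  have h5 := fw (S.s + 2 * k - m) (by omega)
  have h6 := bw (m - (S.s + 1)) (by omega)
  rw [show m + (S.s + 2 * k - m) = S.s + 2 * k by omega, S.hc, x.2.1] at h5
  rw [show m - (m - (S.s + 1)) = S.s + 1 by omega] at h6
  apply S.g_not_mem
  rw [h5, h6]
  exact x.2.2 _

theorem exists_rep (p s n : ℕ) (hp : 0 < p) :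
    ∃ m, s + 1 ≤ m ∧ m ≤ s + p ∧ m % p = n % p := by
  have h1 := Nat.div_add_mod s p
  have h2 := Nat.mod_lt s hp
  have h3 := Nat.mod_lt n hp
  by_cases h : s % p < n % p
  · refine ⟨p * (s / p) + n % p, by omega, by omega, ?_⟩
    rw [Nat.mul_add_mod, Nat.mod_mod]
  · refine ⟨p * (s / p + 1) + n % p, ?_, ?_, ?_⟩
    · rw [mul_add]; omega
    · rw [mul_add]; omega
    · rw [Nat.mul_add_mod, Nat.mod_mod]

theorem dd_periodic (z : Option (Cell S)) : Function.Periodic (dd S e z) (2 * k) := by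
  intro n
  cases z with
  | none =>
    have h1 : S.c (n + 2 * k + 1) = S.c (n + 1) := per_succ S.hc (Nat.add_mod_right n (2 * k))
    simp only [dd, Nat.add_mod_right, S.hc n, lab_periodic k n, h1]
  | some x =>
    have h1 : x.1 (n + 2 * k + 1) = x.1 (n + 1) := per_succ x.2.1 (Nat.add_mod_right n (2 * k))
    simp only [dd, x.2.1 n, lab_periodic k n, h1]

theorem dd_lab (H : Setup S e) (z : Option (Cell S)) (n : ℕ) : (dd S e z n).2.1 = lab k n := by
  cases z with
  | none =>
    simp only [dd]
    split_ifs with h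
    · rw [H.hi]; exact (per_mod (lab_periodic k) h).symm
    · rfl
  | some x => rfl

theorem dd_mem (H : Setup S e) (z : Option (Cell S)) (n : ℕ) : dd S e z n ∈ S.E := by
  cases z with
  | none =>
    simp only [dd]
    split_ifs with h
    · exact H.he
    · exact S.hcE n h
  | some x => exact x.2.2 n

theorem cell_eq (hd : Det S.E) (x x' : Cell S) (n : ℕ) (h : x.1 n = x'.1 n) : x = x' := by
  have fw : ∀ j, x.1 (n + j) = x'.1 (n + j) := by
    intro j
    induction j with
    | zero => exact h
    | succ j ih =>
      have h3 := x.2.2 (n + j)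
      have h4 := x'.2.2 (n + j)
      rw [← ih] at h4
      exact hd.2 _ _ _ _ h3 h4
  apply Subtype.ext
  funext m
  obtain ⟨m', h1, h2, h3⟩ := exists_rep (2 * k) n m (two_k_pos k)
  rw [← per_mod x.2.1 h3, ← per_mod x'.2.1 h3]
  obtain ⟨j, rfl⟩ := Nat.exists_eq_add_of_le (show n ≤ m' by omega)
  exact fw j

theorem dd_none_some (H : Setup S e) (x : Cell S) (n : ℕ) (h : dd S e none n = dd S e (some x) n) :
    False := by
  have hk := two_k_pos k
  simp only [dd] at h
  split_ifs at h with hn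
  · have hx1 : x.1 n = x.1 S.s := per_mod x.2.1 hn
    have hx2 : x.1 (n + 1) = x.1 (S.s + 1) := per_succ x.2.1 hn
    rcases H.hpq with hp | hq
    · apply H.arc x (S.s + 2 * k) (by omega) le_rfl
      rw [S.hc, x.2.1, ← hp, h, hx1]
    · apply H.arc x (S.s + 1) le_rfl (by omega)
      rw [← hq, h, hx2]
  · obtain ⟨m, h1, h2, h3⟩ := exists_rep (2 * k) S.s n hk
    apply H.arc x m h1 h2
    rw [per_mod S.hc h3, per_mod x.2.1 h3]
    exact congrArg Prod.fst h

theorem dd_inj (H : Setup S e) (z z' : Option (Cell S)) (n : ℕ) (h : dd S e z n = dd S e z' n) :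
    z = z' := by
  cases z with
  | none =>
    cases z' with
    | none => rfl
    | some x => exact (dd_none_some H x n h).elim
  | some x' =>
    cases z' with
    | none => exact (dd_none_some H x' n h.symm).elim
    | some x => exact congrArg some (cell_eq H.det x' x n (congrArg Prod.fst h))

theorem bar_mod (n k : ℕ) (hk : 0 < 2 * k) : bar n % (2 * k) = bar (n % (2 * k)) := by
  have h1 := Nat.div_add_mod n (2 * k)
  have h2 := Nat.mod_lt n hk
  have h3 : n % (2 * k) % 2 = n % 2 := Nat.mod_mod_of_dvd n (Dvd.intro k rfl)
  have h4 : bar n = 2 * k * (n / (2 * k)) + bar (n % (2 * k)) := by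
    unfold bar
    rw [h3]
    split_ifs <;> omega
  rw [h4, Nat.mul_add_mod, Nat.mod_eq_of_lt (bar_lt h2)]

theorem sum_closed (c : ℕ → V) (hc : Function.Periodic c (2 * k)) (y : V) :
    ∑ n ∈ Finset.range (2 * k), wt y (c n, lab k n, c (n + 1)) = 0 := by
  classical
  have h2 : ∀ a : ZMod 2, a + a = 0 := by decide
  simp only [wt, Finset.sum_add_distrib]
  have h : ∑ n ∈ Finset.range (2 * k), (if c (n + 1) = y then (1 : ZMod 2) else 0) =
      ∑ n ∈ Finset.range (2 * k), (if c n = y then (1 : ZMod 2) else 0) := by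
    have h3 := Finset.sum_range_succ (fun n => if c n = y then (1 : ZMod 2) else 0) (2 * k)
    have h4 := Finset.sum_range_succ' (fun n => if c n = y then (1 : ZMod 2) else 0) (2 * k)
    have h5 : c (2 * k) = c 0 := by simpa using hc 0
    rw [h4, h5] at h3
    exact add_right_cancel h3
  rw [h, h2]

theorem sum_none (H : Setup S e) {y : V}
    (hy : wt y e + wt y (S.c S.s, lab k S.s, S.c (S.s + 1)) = 1) :
    ∑ n ∈ Finset.range (2 * k), wt y (dd S e none n) = 1 := by
  classical
  have hk := two_k_pos k
  have h1 : ∀ n ∈ Finset.range (2 * k), wt y (dd S e none n) =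
      wt y (S.c n, lab k n, S.c (n + 1)) + if S.s % (2 * k) = n then 1 else 0 := by
    intro n hn
    have hn' := Nat.mod_eq_of_lt (Finset.mem_range.1 hn)
    by_cases h : n % (2 * k) = S.s % (2 * k)
    · have hx1 : S.c n = S.c S.s := per_mod S.hc h
      have hx2 : S.c (n + 1) = S.c (S.s + 1) := per_succ S.hc h
      have hx3 : lab k n = lab k S.s := per_mod (lab_periodic k) h
      rw [if_pos (by omega), hx1, hx2, hx3]
      simp only [dd, if_pos h]
      generalize wt y e = p at *
      generalize wt y (S.c S.s, lab k S.s, S.c (S.s + 1)) = q at *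
      revert p q
      decide
    · rw [if_neg (by omega), add_zero]
      simp only [dd, if_neg h]
  rw [Finset.sum_congr rfl h1, Finset.sum_add_distrib, sum_closed S.c S.hc, Finset.sum_ite_eq,
    if_pos (Finset.mem_range.2 (Nat.mod_lt _ hk)), zero_add]

/-- if all corners occur, every loop closes up: contradiction -/
theorem full_cells_absurd (hφ : Function.Surjective φ) (hd : Det S.E) (Y : Set (Cell S))
    (hne : Y.Nonempty)
    (HY : ∀ x ∈ Y, ∀ n, ∃ x' ∈ Y, (x'.1 (bar n), lab k (bar n), x'.1 (bar n + 1)) =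
      (x.1 n, lab k n, x.1 (n + 1))) : False := by
  have hk := two_k_pos k
  have T1 : ∀ w m, (∃ x ∈ Y, x.1 m = w) → ∃ x ∈ Y, x.1 (m + 1) = w := by
    rintro w m ⟨x, hx, rfl⟩
    by_cases hm : m % 2 = 0
    · obtain ⟨x', hx', h⟩ := HY x hx m
      have e1 : bar m = m + 1 := by simp [bar, hm]
      rw [e1] at h
      exact ⟨x', hx', congrArg Prod.fst h⟩
    · obtain ⟨x', hx', h⟩ := HY x hx (m - 1)
      have e1 : bar (m - 1) = m := by unfold bar; split_ifs <;> omega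
      rw [e1, show m - 1 + 1 = m by omega] at h
      exact ⟨x', hx', congrArg (fun x => x.2.2) h⟩
  have T2 : ∀ w m j, (∃ x ∈ Y, x.1 m = w) → ∃ x ∈ Y, x.1 (m + j) = w := by
    intro w m j
    induction j with
    | zero => exact id
    | succ j ih => exact fun h => T1 w (m + j) (ih h)
  have T3 : ∀ w m n, (∃ x ∈ Y, x.1 m = w) → ∃ x ∈ Y, x.1 n = w := by
    intro w m n h
    obtain ⟨m', h1, h2, h3⟩ := exists_rep (2 * k) m n hk
    obtain ⟨j, rfl⟩ := Nat.exists_eq_add_of_le (show m ≤ m' by omega)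
    obtain ⟨x, hx, hw⟩ := T2 w m j h
    exact ⟨x, hx, by rw [← hw]; exact per_mod x.2.1 h3.symm⟩
  let U : V → Prop := fun w => ∀ n, ∃ x ∈ Y, x.1 n = w
  have U1 : ∀ u i v, (u, i, v) ∈ S.E → U u → U v := by
    intro u i v h hu
    obtain ⟨x, hx, hxu⟩ := hu (2 * i.1)
    have h1 := x.2.2 (2 * i.1)
    have e1 : lab k (2 * i.1) = i := by
      apply Fin.ext; simp [lab, Nat.mod_eq_of_lt i.2]
    rw [hxu, e1] at h1
    have := hd.2 _ _ _ _ h h1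
    exact fun n => T3 v (2 * i.1 + 1) n ⟨x, hx, this.symm⟩
  have U2 : ∀ u i v, (u, i, v) ∈ S.E → U v → U u := by
    intro u i v h hv
    obtain ⟨x, hx, hxu⟩ := hv (2 * i.1 + 1)
    have h1 := x.2.2 (2 * i.1)
    have e1 : lab k (2 * i.1) = i := by
      apply Fin.ext; simp [lab, Nat.mod_eq_of_lt i.2]
    rw [hxu, e1] at h1
    have := hd.1 _ _ _ _ h h1
    exact fun n => T3 u (2 * i.1) n ⟨x, hx, this.symm⟩
  have U3 : ∀ {u w v}, LP S.E u w v → U u → U v := by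
    intro u w v h
    induction h with
    | nil v => exact id
    | fwd e he h ih => exact fun hu => ih (U1 _ _ _ he hu)
    | bwd e he h ih => exact fun hu => ih (U2 _ _ _ he hu)
  have hU : ∀ v, U v := by
    obtain ⟨x, hx⟩ := hne
    have h0 : U (x.1 0) := fun n => T3 _ 0 n ⟨x, hx, rfl⟩
    obtain ⟨w, hw⟩ := S.conn (x.1 0)
    have h1 : U S.v0 := U3 hw.symm h0
    intro v
    obtain ⟨w, hw⟩ := S.conn v
    exact U3 hw h1
  have ex : ∀ (x : FreeGroup (Fin k)) (u : V), ∃ v, LP S.E u x v := by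
    intro x
    have hlab : ∀ i : Fin k, lab k (2 * i.1) = i := by
      intro i
      apply Fin.ext; simp [lab, Nat.mod_eq_of_lt i.2]
    induction x using FreeGroup.induction_on with
    | C1 => exact fun u => ⟨u, GPath.nil u⟩
    | of i =>
      intro u
      obtain ⟨x, hx, hxu⟩ := hU u (2 * i.1)
      have h1 := x.2.2 (2 * i.1)
      rw [hxu, hlab] at h1
      exact ⟨_, LP.single h1⟩
    | inv_of i _ =>
      intro u
      obtain ⟨x, hx, hxu⟩ := hU u (2 * i.1 + 1)
      have h1 := x.2.2 (2 * i.1)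
      rw [hxu, hlab] at h1
      exact ⟨_, (LP.single h1).symm⟩
    | mul x y hx hy =>
      intro u
      obtain ⟨v, hv⟩ := hx u
      obtain ⟨z, hz⟩ := hy v
      exact ⟨z, hv.trans hz⟩
  let Nn : Subgroup (FreeGroup (Fin k)) :=
    { carrier := {x | ∀ u, LP S.E u x u}
      one_mem' := fun u => GPath.nil u
      mul_mem' := fun hx hy u => (hx u).trans (hy u)
      inv_mem' := fun hx u => (hx u).symm }
  have hNn : Nn.Normal := ⟨fun x hx y u => by
    obtain ⟨v, hv⟩ := ex y u
    exact (hv.trans (hx v)).trans hv.symm⟩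
  have hrel : nonorientableRelator k ∈ Nn := by
    intro u
    obtain ⟨x, hx, hxu⟩ := hU u 0
    have := GPath.ofSeq (src := fun e : V × Fin k × V => e.1) (tgt := fun e => e.2.2)
      (ℓ := fun e => FreeGroup.of e.2.1) (E := S.E) (fun n => (x.1 n, lab k n, x.1 (n + 1))) x.1
      0 (2 * k) (fun m _ _ => ⟨x.2.2 m, rfl, rfl⟩)
    rw [zero_add] at this
    have h5 : x.1 (2 * k) = x.1 0 := by simpa using x.2.1 0
    rw [h5, hxu] at this
    have h6 := relator_eq k
    rw [← h6]
    exact this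
  have hker : Subgroup.normalClosure {nonorientableRelator k} ≤ Nn :=
    Subgroup.normalClosure_le_normal (by simpa using hrel)
  obtain ⟨w, hw⟩ := S.proper
  apply hw
  obtain ⟨y, hy⟩ := hφ (standardRho k w)
  have h1 : (S.μ y)⁻¹ * w ∈ Nn := by
    apply hker
    apply rho_eq_one
    rw [map_mul, map_inv, S.hμ, hy]
    simp
  have := (S.hr y).trans (h1 S.v0)
  simpa using this

theorem free_edge (hφ : Function.Surjective φ) (H : Setup S e) (Y : Finset (Option (Cell S)))
    (hne : Y.Nonempty) : ∃ z ∈ Y, ∃ n, ∀ z' ∈ Y, ∀ n', dd S e z' n' = dd S e z n →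
      z' = z ∧ n' % (2 * k) = n % (2 * k) := by
  classical
  have hk := two_k_pos k
  by_contra hcon
  push Not at hcon
  have HY : ∀ z ∈ Y, ∀ n, ∃ z' ∈ Y, dd S e z' (bar n) = dd S e z n := by
    intro z hz n
    obtain ⟨z', hz', n', h, hne⟩ := hcon z hz n
    have h1 : lab k n' = lab k n := by
      rw [← dd_lab H z' n', h, dd_lab H]
    rw [← lab_mod k n', ← lab_mod k n] at h1
    rcases lab_eq_lt k (Nat.mod_lt n hk) (Nat.mod_lt n' hk) h1 with h2 | h2
    · exfalso
      refine hne ?_ h2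
      apply dd_inj H z' z n
      rw [← h]
      exact per_mod (dd_periodic z') h2.symm
    · refine ⟨z', hz', ?_⟩
      rw [← h]
      apply per_mod (dd_periodic z')
      rw [h2, bar_mod n k hk]
  by_cases hnone : none ∈ Y
  · obtain ⟨y, hy⟩ := H.hy
    choose! f hf hf' using HY
    have hsum : ∑ p ∈ Y ×ˢ Finset.range (2 * k), wt y (dd S e p.1 p.2) = 0 := by
      refine Finset.sum_involution (fun p _ => (f p.1 p.2, bar p.2)) ?_ ?_ ?_ ?_
      · intro p hp
        have h2 : ∀ a : ZMod 2, a + a = 0 := by decide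
        rw [hf' _ (Finset.mem_product.1 hp).1, h2]
      · intro p hp _ h
        exact bar_ne p.2 (congrArg Prod.snd h)
      · intro p hp
        obtain ⟨h1, h2⟩ := Finset.mem_product.1 hp
        exact Finset.mem_product.2 ⟨hf _ h1 _, Finset.mem_range.2 (bar_lt (Finset.mem_range.1 h2))⟩
      · intro p hp
        obtain ⟨h1, h2⟩ := Finset.mem_product.1 hp
        have h3 := hf' _ (hf _ h1 p.2) (bar p.2)
        rw [hf' _ h1, bar_bar] at h3
        exact Prod.ext (dd_inj H _ _ _ h3) (bar_bar _)
    rw [Finset.sum_product, ← Finset.add_sum_erase _ _ hnone, sum_none H hy,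
      Finset.sum_eq_zero] at hsum
    · revert hsum; decide
    · intro z hz
      cases z with
      | none => simp at hz
      | some x => exact sum_closed x.1 x.2.1 y
  · refine full_cells_absurd hφ H.det {x | some x ∈ Y} ?_ ?_
    · obtain ⟨z, hz⟩ := hne
      cases z with
      | none => exact absurd hz hnone
      | some x => exact ⟨x, hz⟩
    · intro x hx n
      obtain ⟨z', hz', h⟩ := HY (some x) hx n
      cases z' with
      | none => exact absurd hz' hnone
      | some x' => exact ⟨x', hz', h⟩

theorem cell_finite [Finite V] (hd : Det S.E) : Finite (Cell S) :=
  Finite.of_injective (fun x : Cell S => x.1 0) (fun x x' h => cell_eq hd x x' 0 h)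

end merge


/-! ### The folding step -/

section fold
variable {k : ℕ} [NeZero k] {φ : FreeGroup (Fin k) →* NonorientableSurfaceGroup k}
variable {V W : Type}

/-- free paths: labels in the free group on the edges -/
abbrev FP (E : Set (V × Fin k × V)) (u : V) (w : FreeGroup (V × Fin k × V)) (v : V) : Prop :=
  GPath (fun e : V × Fin k × V => e.1) (fun e => e.2.2) FreeGroup.of E u w v

abbrev lbl : V × Fin k × V → Fin k := fun e => e.2.1

theorem FP.inj [Finite V] {E : Set (V × Fin k × V)} (hd : Det E) {u v : V}
    {b b' : FreeGroup (V × Fin k × V)} (h : FP E u b v) (h' : FP E u b' v)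
    (hbb : FreeGroup.map lbl b = FreeGroup.map lbl b') : b = b' := by
  obtain ⟨Θ, hΘ⟩ := exists_action hd (FreeGroup.of : V × Fin k × V → _)
  have key : ∀ {b}, FP E u b v → Θ (FreeGroup.map lbl b) (v, 1) = (u, b) := by
    intro b h
    have h1 := h.subst (src' := fun e : V × Fin k × V => e.1) (tgt' := fun e => e.2.2)
      (ℓ' := fun e => (FreeGroup.of e.2.1, FreeGroup.of e)) (E' := E) id
      ((FreeGroup.map lbl).prod (MonoidHom.id _)) (fun e he => by
        have e1 : ((FreeGroup.map lbl).prod (MonoidHom.id _)) (FreeGroup.of e) =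
          (fun e : V × Fin k × V => (FreeGroup.of e.2.1, FreeGroup.of e)) e := by
            simp [lbl]
        rw [e1]
        exact GPath.single (ℓ := fun e : V × Fin k × V => (FreeGroup.of e.2.1, FreeGroup.of e)) e he)
    have h2 := hΘ _ _ _ h1 1
    simpa using h2
  have h1 := key h
  have h2 := key h'
  rw [hbb, h2] at h1
  exact (congrArg Prod.snd h1).symm

theorem FP.toLP {E : Set (V × Fin k × V)} {u v : V}
    {b : FreeGroup (V × Fin k × V)} (h : FP E u b v) : LP E u (FreeGroup.map lbl b) v := by
  refine h.subst id (FreeGroup.map lbl) (fun e he => ?_)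
  rw [FreeGroup.map.of]
  exact GPath.single (ℓ := fun e : V × Fin k × V => FreeGroup.of e.2.1) e he

theorem LP.toFP {E : Set (V × Fin k × V)} {u v : V}
    {w : FreeGroup (Fin k)} (h : LP E u w v) : ∃ b, FreeGroup.map lbl b = w ∧ FP E u b v :=
  GPath.lift (FreeGroup.map lbl) FreeGroup.of (fun _ => FreeGroup.map.of) h

variable {S : St φ V} {e : V × Fin k × V}

theorem fold_step [Finite V] (hφ : Function.Surjective φ) (H : Setup S e) (π : V → W)
    (hsurj : Function.Surjective π)
    (hp : π e.1 = π (S.c S.s)) (hq : π e.2.2 = π (S.c (S.s + 1)))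
    (b : V) (t : ℕ)
    (hC : FP S.E (dd S e none t).1 (sp (fun m => FreeGroup.of (dd S e none m)) t (2 * k)) b)
    (hπ : ∀ x y, π x = π y → x = y ∨ (x = (dd S e none t).1 ∧ y = b) ∨
      (x = b ∧ y = (dd S e none t).1)) :
    Goal φ ∨ Nonempty (St φ W) := by
  classical
  have hk := two_k_pos k
  have := cell_finite H.det
  have := Fintype.ofFinite (Cell S)
  -- the lift of `μ`
  have hM0 : ∀ i : Fin k, ∃ b, FreeGroup.map lbl b = S.μ (FreeGroup.of i) ∧ FP S.E S.v0 b S.v0 :=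
    fun i => LP.toFP (S.hr _)
  choose M0 hM1 hM2 using hM0
  let M : FreeGroup (Fin k) →* FreeGroup (V × Fin k × V) := FreeGroup.lift M0
  have hMμ : ∀ x, FreeGroup.map lbl (M x) = S.μ x := by
    have : (FreeGroup.map lbl).comp M = S.μ := by
      ext i
      simp [M, hM1]
    exact fun x => DFunLike.congr_fun this x
  have hM : ∀ x, FP S.E S.v0 (M x) S.v0 := by
    intro x
    have : (M x) ∈ GPath.loops (fun e : V × Fin k × V => e.1) (fun e => e.2.2) FreeGroup.of S.E S.v0 := by
      induction x using FreeGroup.induction_on with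
      | C1 => rw [map_one]; exact one_mem _
      | of i => simp only [M, FreeGroup.lift_apply_of]; exact hM2 i
      | inv_of i h => rw [map_inv]; exact inv_mem h
      | mul x y hx hy => rw [map_mul]; exact mul_mem hx hy
    exact this
  let src : V × Fin k × V → W := fun e => π e.1
  let tgt : V × Fin k × V → W := fun e => π e.2.2
  have up : ∀ {u w v}, FP S.E u w v → GPath src tgt FreeGroup.of S.E (π u) w (π v) := by
    intro u w v h
    exact h.subst π (MonoidHom.id _) (fun e he => GPath.single (src := src) (tgt := tgt) e he)
  let J : Subgroup (FreeGroup (V × Fin k × V)) := Subgroup.closure (Set.range M ∪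
        {y | ∃ z ∈ (Finset.univ : Finset (Option (Cell S))), ∃ (t : ℕ) (h : FreeGroup (V × Fin k × V)),
          GPath src tgt FreeGroup.of S.E (π S.v0) h (src (dd S e z t)) ∧
          y = h * sp (fun m => FreeGroup.of (dd S e z m)) t (2 * k) * h⁻¹})
  have hJc : ∀ z t h, GPath src tgt FreeGroup.of S.E (π S.v0) h (src (dd S e z t)) →
      h * sp (fun m => FreeGroup.of (dd S e z m)) t (2 * k) * h⁻¹ ∈ J :=
    fun z t h hh => Subgroup.subset_closure (Or.inr ⟨z, Finset.mem_univ z, t, h, hh, rfl⟩)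
  have lbsp : ∀ z t m, FreeGroup.map lbl (sp (fun m => FreeGroup.of (dd S e z m)) t m) = sp (X k) t m := by
    intro z t m
    rw [map_sp]
    apply sp_congr
    intro m _ _
    simp only [FreeGroup.map.of, X, lbl, dd_lab H]
  -- loops upstairs
  have genV : ∀ b, FP S.E S.v0 b S.v0 → b ∈ J := by
    intro b hb
    have h1 := S.gen _ hb.toLP
    let L := GPath.loops (fun e : V × Fin k × V => e.1) (fun e => e.2.2) FreeGroup.of S.E S.v0
    have h2 : FreeGroup.map lbl b ∈ (J ⊓ L).map (FreeGroup.map lbl) := by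
      refine (Subgroup.closure_le _).2 ?_ h1
      rintro y (⟨x, rfl⟩ | ⟨c, t, h, hc, hcE, hp, rfl⟩)
      · exact ⟨M x, ⟨Subgroup.subset_closure (Or.inl ⟨x, rfl⟩), hM x⟩, hMμ x⟩
      · obtain ⟨h', rfl, hh'⟩ := LP.toFP hp
        let z : Cell S := ⟨c, hc, hcE⟩
        refine ⟨h' * sp (fun m => FreeGroup.of (dd S e (some z) m)) t (2 * k) * h'⁻¹,
          ⟨hJc (some z) t h' (up hh'), ?_⟩, ?_⟩
        · have h3 := GPath.ofSeq (src := fun e : V × Fin k × V => e.1) (tgt := fun e => e.2.2)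
            (ℓ := FreeGroup.of) (E := S.E) (dd S e (some z)) c
            t (2 * k) (fun m _ _ => ⟨hcE m, rfl, rfl⟩)
          rw [hc] at h3
          exact (hh'.trans h3).trans hh'.symm
        · simp only [map_mul, map_inv, lbsp]
    obtain ⟨b', ⟨hbJ, hbL⟩, hb'⟩ := h2
    have : b' = b := FP.inj H.det hbL hb hb'
    rw [← this]
    exact hbJ
  have glue : ∀ x y, π x = π y → ∀ α β, FP S.E S.v0 α x → FP S.E S.v0 β y → α * β⁻¹ ∈ J := by
    have main : ∀ α β, FP S.E S.v0 α (dd S e none t).1 → FP S.E S.v0 β b → α * β⁻¹ ∈ J := by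
      intro α β hα hβ
      have h1 := genV _ ((hα.trans hC).trans hβ.symm)
      have h2 := hJc none t α (up hα)
      have h3 := mul_mem (inv_mem h2) h1
      convert h3 using 1
      group
    intro x y hxy α β hα hβ
    rcases hπ x y hxy with rfl | ⟨rfl, rfl⟩ | ⟨rfl, rfl⟩
    · exact genV _ (hα.trans hβ.symm)
    · exact main α β hα hβ
    · have := inv_mem (main β α hβ hα)
      simpa using this
  have genW : ∀ {x' w y'}, GPath src tgt FreeGroup.of S.E x' w y' → ∀ x y, π x = x' → π y = y' →
      ∀ α β, FP S.E S.v0 α x → FP S.E S.v0 β y → α * w * β⁻¹ ∈ J := by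
    intro x' w y' h
    induction h with
    | nil v =>
      intro x y hx hy α β hα hβ
      rw [mul_one]
      exact glue x y (hx.trans hy.symm) α β hα hβ
    | fwd e' he' h ih =>
      intro x y hx hy α β hα hβ
      obtain ⟨w', hw'⟩ := S.conn e'.1
      obtain ⟨α', -, hα'⟩ := LP.toFP hw'
      have h1 := glue x e'.1 hx α α' hα hα'
      have h2 := ih e'.2.2 y rfl hy (α' * FreeGroup.of e') β
        (hα'.trans (GPath.single (src := fun e : V × Fin k × V => e.1) (tgt := fun e => e.2.2)
          e' he')) hβ
      convert mul_mem h1 h2 using 1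
      group
    | bwd e' he' h ih =>
      intro x y hx hy α β hα hβ
      obtain ⟨w', hw'⟩ := S.conn e'.2.2
      obtain ⟨α', -, hα'⟩ := LP.toFP hw'
      have h1 := glue x e'.2.2 hx α α' hα hα'
      have h2 := ih e'.1 y rfl hy (α' * (FreeGroup.of e')⁻¹) β
        (hα'.trans (GPath.single_inv (src := fun e : V × Fin k × V => e.1) (tgt := fun e => e.2.2)
          e' he')) hβ
      convert mul_mem h1 h2 using 1
      group
  have hsrc : ∀ n, π (dd S e none n).1 = π (S.c n) := by
    intro n
    simp only [dd]
    split_ifs with h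
    · rw [hp, per_mod S.hc h]
    · rfl
  have htgt : ∀ n, π (dd S e none n).2.2 = π (S.c (n + 1)) := by
    intro n
    simp only [dd]
    split_ifs with h
    · rw [hq, per_succ S.hc h]
    · rfl
  refine collapse (φ := φ) src tgt lbl (π S.v0) (dd S e) dd_periodic (dd_lab H) ?_ (free_edge hφ H)
    Finset.univ S.E M (fun z _ n => dd_mem H z n) ?_ (fun x => up (hM x)) ?_ ?_ ?_
  · intro z n
    cases z with
    | none => simp only [src, tgt]; rw [hsrc, htgt]
    | some x => rfl
  · intro v
    obtain ⟨v, rfl⟩ := hsurj v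
    obtain ⟨w, hw⟩ := S.conn v
    obtain ⟨b, -, hb⟩ := LP.toFP hw
    exact ⟨b, up hb⟩
  · intro x
    rw [hMμ, S.hμ]
  · intro w hw
    have := genW hw S.v0 S.v0 rfl rfl 1 1 (GPath.nil _) (GPath.nil _)
    have h' : w ∈ J := by simpa using this
    exact h'
  · intro w
    refine (S.full w).subst π (MonoidHom.id _) ?_
    rintro e' (rfl | he')
    · have := GPath.single (src := src) (tgt := tgt) (ℓ := fun e => FreeGroup.of (lbl e)) e H.he
      simp only [src, tgt, lbl, hp, hq, H.hi] at this
      exact this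
    · exact GPath.single (src := src) (tgt := tgt) (ℓ := fun e => FreeGroup.of (lbl e)) e' he'

end fold


/-! ### The main induction -/

section main
variable {k : ℕ} [NeZero k] {φ : FreeGroup (Fin k) →* NonorientableSurfaceGroup k}

theorem exists_merge {V : Type} [Finite V] (a b : V) (hab : a ≠ b) :
    ∃ (W : Type) (_ : Finite W) (_ : Nat.card W < Nat.card V) (π : V → W), Function.Surjective π ∧
      π a = π b ∧ ∀ x y, π x = π y → x = y ∨ (x = a ∧ y = b) ∨ (x = b ∧ y = a) := by
  classical
  refine ⟨{x : V // x ≠ b}, inferInstance, ?_,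
    fun x => if h : x = b then ⟨a, hab⟩ else ⟨x, h⟩, ?_, ?_, ?_⟩
  · have := Fintype.ofFinite V
    rw [Nat.card_eq_fintype_card, Nat.card_eq_fintype_card]
    exact Fintype.card_subtype_lt (x := b) (by simp)
  · rintro ⟨x, hx⟩
    exact ⟨x, by simp [hx]⟩
  · simp [hab]
  · intro x y h
    by_cases hx : x = b <;> by_cases hy : y = b
    · exact Or.inl (hx.trans hy.symm)
    · simp only [hx, hy, dite_true, dite_false, Subtype.mk.injEq] at h
      exact Or.inr (Or.inr ⟨hx, h.symm⟩)
    · simp only [hx, hy, dite_true, dite_false, Subtype.mk.injEq] at h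
      exact Or.inr (Or.inl ⟨h, hy⟩)
    · simp only [hx, hy, dite_false, Subtype.mk.injEq] at h
      exact Or.inl h

theorem dd_none_ne {V : Type} {S : St φ V} {e : V × Fin k × V} {n : ℕ}
    (h : n % (2 * k) ≠ S.s % (2 * k)) : dd S e none n = (S.c n, lab k n, S.c (n + 1)) := by
  simp only [dd, if_neg h]

theorem dd_none_eq {V : Type} {S : St φ V} {e : V × Fin k × V} {n : ℕ}
    (h : n % (2 * k) = S.s % (2 * k)) : dd S e none n = e := by
  simp only [dd, if_pos h]

theorem St.goal (hφ : Function.Surjective φ) : ∀ (n : ℕ) (V : Type) (_ : Finite V),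
    Nat.card V ≤ n → St φ V → Goal φ := by
  intro n
  induction n with
  | zero =>
    intro V _ hV S
    have : Nonempty V := ⟨S.v0⟩
    have := Nat.card_pos (α := V)
    omega
  | succ n ih =>
    intro V0 _ hV0 S0
    classical
    have hk := two_k_pos k
    obtain ⟨V, _, hV, S, hdet⟩ := S0.exists_det
    have fin : ∀ (W : Type) (_ : Finite W), Nat.card W < Nat.card V → Goal φ ∨ Nonempty (St φ W) →
        Goal φ := by
      rintro W _ hW (h | ⟨⟨S'⟩⟩)
      · exact h
      · exact ih W inferInstance (by omega) S'
    have hg := S.g_not_mem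
    have hs1 : (S.s + 1) % (2 * k) ≠ S.s % (2 * k) := mod_ne (by omega) (by omega)
    have zz : (0 : ZMod 2) + 0 = 0 := by decide
    by_cases h1 : ∃ v, (S.c S.s, lab k S.s, v) ∈ S.E
    · obtain ⟨v', hv'⟩ := h1
      have hne : S.c (S.s + 1) ≠ v' := by
        rintro rfl; exact hg hv'
      set e : V × Fin k × V := (S.c S.s, lab k S.s, v') with he
      have H : Setup S e := ⟨hdet, hv', rfl, Or.inl rfl, S.c (S.s + 1), by
        have h3 : ∀ a : ZMod 2, a + 0 + (a + 1) = 1 := by decide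
        simp only [wt, he, if_neg hne.symm, if_true]
        exact h3 _⟩
      have h4 : (dd S e none (S.s + 1)).1 = S.c (S.s + 1) := by rw [dd_none_ne hs1]
      obtain ⟨W, _, hW, π, hsurj, hab, hπ⟩ := exists_merge (S.c (S.s + 1)) v' hne
      refine fin W inferInstance hW
        (fold_step hφ H π hsurj rfl hab.symm v' (S.s + 1) ?_ (by rw [h4]; exact hπ))
      have h5 := GPath.ofSeq (src := fun e : V × Fin k × V => e.1) (tgt := fun e => e.2.2)
            (ℓ := FreeGroup.of) (E := S.E) (dd S e none)
            (fun m => if m = S.s + 1 + 2 * k then v' else S.c m)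
            (S.s + 1) (2 * k) (fun m hm1 hm2 => ⟨dd_mem H none m, ?_⟩)
      · rw [h4]
        simp only [if_true, if_neg (show S.s + 1 ≠ S.s + 1 + 2 * k by omega)] at h5
        exact h5
      · rw [if_neg (by omega)]
        by_cases hm : m = S.s + 2 * k
        · rw [dd_none_eq (by rw [hm, Nat.add_mod_right]), if_pos (by omega), hm, S.hc]
          exact ⟨rfl, rfl⟩
        · rw [dd_none_ne (mod_ne (by omega) (by omega)), if_neg (by omega)]
          exact ⟨rfl, rfl⟩
    by_cases h2 : ∃ u, (u, lab k S.s, S.c (S.s + 1)) ∈ S.E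
    · obtain ⟨u', hu'⟩ := h2
      have hne : u' ≠ S.c S.s := by
        rintro rfl; exact hg hu'
      set e : V × Fin k × V := (u', lab k S.s, S.c (S.s + 1)) with he
      have H : Setup S e := ⟨hdet, hu', rfl, Or.inr rfl, S.c S.s, by
        have h3 : ∀ a : ZMod 2, 0 + a + (1 + a) = 1 := by decide
        simp only [wt, he, if_neg hne, if_true]
        exact h3 _⟩
      have h4 : (dd S e none S.s).1 = u' := by rw [dd_none_eq rfl]
      obtain ⟨W, _, hW, π, hsurj, hab, hπ⟩ := exists_merge u' (S.c S.s) hne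
      refine fin W inferInstance hW
        (fold_step hφ H π hsurj hab rfl (S.c S.s) S.s ?_ (by rw [h4]; exact hπ))
      have h5 := GPath.ofSeq (src := fun e : V × Fin k × V => e.1) (tgt := fun e => e.2.2)
            (ℓ := FreeGroup.of) (E := S.E) (dd S e none)
            (fun m => if m = S.s then u' else S.c m)
            S.s (2 * k) (fun m hm1 hm2 => ⟨dd_mem H none m, ?_⟩)
      · rw [h4]
        simp only [if_true, if_neg (show S.s + 2 * k ≠ S.s by omega), S.hc S.s] at h5
        exact h5
      · rw [if_neg (show m + 1 ≠ S.s by omega)]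
        by_cases hm : m = S.s
        · rw [dd_none_eq (by rw [hm]), if_pos hm, hm]
          exact ⟨rfl, rfl⟩
        · rw [dd_none_ne (mod_ne (by omega) (by omega)), if_neg (by omega)]
          exact ⟨rfl, rfl⟩
    · push Not at h1 h2
      exact (S.case_i hdet h1 h2).elim

end main


/-! ### The initial state -/

section initial
variable {k : ℕ} [NeZero k] {φ : FreeGroup (Fin k) →* NonorientableSurfaceGroup k}

theorem exists_finset_conj (n : FreeGroup (Fin k))
    (hn : n ∈ Subgroup.normalClosure {nonorientableRelator k}) :
    ∃ T : Finset (FreeGroup (Fin k)),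
      n ∈ Subgroup.closure ((fun h => h * nonorientableRelator k * h⁻¹) '' (T : Set _)) := by
  classical
  have hn' : n ∈ Subgroup.closure (Group.conjugatesOfSet {nonorientableRelator k}) := hn
  clear hn
  induction hn' using Subgroup.closure_induction with
  | mem x hx =>
    obtain ⟨a, ha, hax⟩ := Group.mem_conjugatesOfSet_iff.1 hx
    have ha' : a = nonorientableRelator k := ha
    obtain ⟨c, hc⟩ := isConj_iff.1 hax
    rw [ha'] at hc
    exact ⟨{c}, Subgroup.subset_closure ⟨c, by simp, hc⟩⟩
  | one => exact ⟨∅, one_mem _⟩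
  | mul x y _ _ h1 h2 =>
    obtain ⟨T, hT⟩ := h1
    obtain ⟨T', hT'⟩ := h2
    refine ⟨T ∪ T', mul_mem (Subgroup.closure_mono ?_ hT) (Subgroup.closure_mono ?_ hT')⟩
    · exact Set.image_mono (by simp)
    · exact Set.image_mono (by simp)
  | inv x _ h1 =>
    obtain ⟨T, hT⟩ := h1
    exact ⟨T, inv_mem hT⟩

/-- subgroup generated by a lift of `φ` and finitely many conjugates of the relator -/
def KK (μ : FreeGroup (Fin k) →* FreeGroup (Fin k)) (T : Set (FreeGroup (Fin k))) :
    Subgroup (FreeGroup (Fin k)) :=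
  Subgroup.closure (Set.range μ ∪ (fun h => h * nonorientableRelator k * h⁻¹) '' T)

theorem exists_finset_top (hφ : Function.Surjective φ) (μ : FreeGroup (Fin k) →* FreeGroup (Fin k))
    (hμ : ∀ x, standardRho k (μ x) = φ x) :
    ∃ T : Finset (FreeGroup (Fin k)), KK μ (T : Set _) = ⊤ := by
  classical
  have h : ∀ i : Fin k, ∃ T : Finset (FreeGroup (Fin k)), FreeGroup.of i ∈ KK μ (T : Set _) := by
    intro i
    obtain ⟨y, hy⟩ := hφ (standardRho k (FreeGroup.of i))
    have h1 : (μ y)⁻¹ * FreeGroup.of i ∈ Subgroup.normalClosure {nonorientableRelator k} := by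
      apply rho_eq_one
      rw [map_mul, map_inv, hμ, hy]
      simp
    obtain ⟨T, hT⟩ := exists_finset_conj _ h1
    refine ⟨T, ?_⟩
    have h2 : μ y ∈ KK μ (T : Set _) := Subgroup.subset_closure (Or.inl ⟨y, rfl⟩)
    have h3 : (μ y)⁻¹ * FreeGroup.of i ∈ KK μ (T : Set _) :=
      Subgroup.closure_mono Set.subset_union_right hT
    simpa using mul_mem h2 h3
  choose T hT using h
  refine ⟨Finset.univ.biUnion T, ?_⟩
  rw [eq_top_iff, ← FreeGroup.closure_range_of, Subgroup.closure_le]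
  rintro _ ⟨i, rfl⟩
  refine Subgroup.closure_mono ?_ (hT i)
  apply Set.union_subset_union_right
  apply Set.image_mono
  intro x hx
  simp only [Finset.coe_biUnion, Set.mem_iUnion]
  exact ⟨i, by simp, hx⟩

theorem exists_minimal_conj (μ : FreeGroup (Fin k) →* FreeGroup (Fin k))
    (hμ : ∀ x, standardRho k (μ x) = φ x) (T : Finset (FreeGroup (Fin k))) :
    KK μ (T : Set _) = ⊤ → Goal φ ∨ ∃ (T : Finset (FreeGroup (Fin k))) (h : FreeGroup (Fin k)),
      KK μ (T : Set _) ≠ ⊤ ∧ KK μ (insert h (T : Set _)) = ⊤ := by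
  classical
  induction T using Finset.induction_on with
  | empty =>
    intro h
    left
    refine ⟨μ, ?_, hμ⟩
    rw [← MonoidHom.range_eq_top, ← h]
    simp only [KK, Finset.coe_empty, Set.image_empty, Set.union_empty]
    rw [← MonoidHom.coe_range, Subgroup.closure_eq]
  | insert h T _ ih =>
    intro hT
    by_cases hT' : KK μ (T : Set _) = ⊤
    · exact ih hT'
    · right
      refine ⟨T, h, hT', ?_⟩
      rwa [Finset.coe_insert] at hT

theorem init_state (μ : FreeGroup (Fin k) →* FreeGroup (Fin k))
    (hμ : ∀ x, standardRho k (μ x) = φ x) (T : Finset (FreeGroup (Fin k)))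
    (h : FreeGroup (Fin k)) (hT : KK μ (T : Set _) ≠ ⊤) (hT' : KK μ (insert h (T : Set _)) = ⊤) :
    ∃ (V : Type) (_ : Finite V), Nonempty (St φ V) := by
  classical
  have hk := two_k_pos k
  set K := KK μ (T : Set _) with hK
  let A : Finset (FreeGroup (Fin k)) := (Finset.univ.image fun i => μ (FreeGroup.of i)) ∪
    ((insert h T) ×ˢ (Finset.range (2 * k))).image fun p => p.1 * sp (X k) 0 p.2
  let N := 1 + A.sup FreeGroup.norm
  have hA : ∀ x ∈ A, x.norm ≤ N := fun x hx =>
    (Finset.le_sup (f := FreeGroup.norm) hx).trans (Nat.le_add_left _ _)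
  have hA1 : ∀ i, (μ (FreeGroup.of i)).norm ≤ N := fun i =>
    hA _ (Finset.mem_union_left _ (Finset.mem_image_of_mem _ (Finset.mem_univ i)))
  have hA2 : ∀ h' ∈ insert h T, ∀ n, (h' * sp (X k) 0 (n % (2 * k))).norm ≤ N := fun h' hh n =>
    hA _ (Finset.mem_union_right _ (Finset.mem_image.2 ⟨(h', n % (2 * k)),
      Finset.mem_product.2 ⟨hh, Finset.mem_range.2 (Nat.mod_lt _ hk)⟩, rfl⟩))
  let B := Ball (Fin k) N
  let cB : ∀ h' ∈ insert h T, ℕ → B := fun h' hh n => ⟨h' * sp (X k) 0 (n % (2 * k)), hA2 h' hh n⟩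
  let E : Set (B × Fin k × B) := {e | e.1.1 * FreeGroup.of e.2.1 * e.2.2.1⁻¹ ∈ K}
  have hE : ∀ (b b' : B) i, b'.1 = b.1 * FreeGroup.of i → (b, i, b') ∈ E := by
    intro b b' i hb
    show b.1 * FreeGroup.of i * b'.1⁻¹ ∈ K
    rw [hb, mul_inv_cancel]
    exact one_mem _
  let v0 : B := ⟨1, by simp⟩
  have conn : ∀ b : B, LP E v0 b.1 b := fun b => ball_path' hE v0 b rfl
  have inK : ∀ {u w v}, LP E u w v → u.1 * w * v.1⁻¹ ∈ K := by
    intro u w v hp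
    induction hp with
    | nil v => rw [mul_one, mul_inv_cancel]; exact one_mem _
    | fwd e he hp ih =>
      have he' : e.1.1 * FreeGroup.of e.2.1 * e.2.2.1⁻¹ ∈ K := he
      convert mul_mem he' ih using 1
      group
    | bwd e he hp ih =>
      have he' : e.1.1 * FreeGroup.of e.2.1 * e.2.2.1⁻¹ ∈ K := he
      convert mul_mem (inv_mem he') ih using 1
      group
  have inK0 : ∀ w, LP E v0 w v0 → w ∈ K := by
    intro w hw
    have := inK hw
    simpa [v0] using this
  have ret : ∀ b : B, b.1 ∈ K → LP E b 1 v0 := by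
    intro b hb
    let i0 : Fin k := lab k 0
    let x0 : B := ⟨FreeGroup.of i0, by rw [FreeGroup.norm_of]; exact Nat.le_add_right _ _⟩
    have h1 : (b, i0, x0) ∈ E := by
      show b.1 * FreeGroup.of i0 * (FreeGroup.of i0)⁻¹ ∈ K
      simpa using hb
    have h2 : (v0, i0, x0) ∈ E := hE _ _ _ (by simp [v0, x0])
    simpa using (LP.single h1).trans (LP.single h2).symm
  have hr : ∀ x, LP E v0 (μ x) v0 := by
    intro x
    have : μ x ∈ GPath.loops (fun e : B × Fin k × B => e.1) (fun e => e.2.2)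
        (fun e => FreeGroup.of e.2.1) E v0 := by
      induction x using FreeGroup.induction_on with
      | C1 => rw [map_one]; exact one_mem _
      | of i =>
        have h1 := (conn ⟨_, hA1 i⟩).trans (ret ⟨_, hA1 i⟩
          (Subgroup.subset_closure (Or.inl ⟨_, rfl⟩)))
        rw [mul_one] at h1
        exact h1
      | inv_of i h => rw [map_inv]; exact inv_mem h
      | mul x y hx hy => rw [map_mul]; exact mul_mem hx hy
    exact this
  have cper : ∀ h' hh, Function.Periodic (cB h' hh) (2 * k) := by
    intro h' hh n
    simp only [cB, Nat.add_mod_right]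
  have c0 : ∀ h' hh, LP E v0 h' (cB h' hh 0) := by
    intro h' hh
    have := conn (cB h' hh 0)
    simpa [cB, sp] using this
  have cE1 : ∀ h' hh n, n % (2 * k) ≠ (2 * k - 1) % (2 * k) →
      (cB h' hh n, lab k n, cB h' hh (n + 1)) ∈ E := by
    intro h' hh n hn
    rw [Nat.mod_eq_of_lt (show 2 * k - 1 < 2 * k by omega)] at hn
    apply hE
    have h1 := Nat.mod_lt n hk
    have h2 : (n + 1) % (2 * k) = n % (2 * k) + 1 := by
      rw [Nat.add_mod_eq_ite, Nat.mod_eq_of_lt (show 1 < 2 * k by omega), if_neg (by omega)]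
    simp only [cB, h2, sp, zero_add, X, lab_mod, mul_assoc]
  have cE2 : ∀ h' hh, h' ∈ T → ∀ n, (cB h' hh n, lab k n, cB h' hh (n + 1)) ∈ E := by
    intro h' hh hT n
    by_cases hn : n % (2 * k) = (2 * k - 1) % (2 * k)
    · have h2 : (n + 1) % (2 * k) = 0 := by
        have h3 : n + 1 ≡ 2 * k - 1 + 1 [MOD 2 * k] := Nat.ModEq.add_right 1 hn
        rw [show 2 * k - 1 + 1 = 2 * k by omega] at h3
        have h4 : (n + 1) % (2 * k) = (2 * k) % (2 * k) := h3
        rw [h4, Nat.mod_self]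
      show h' * sp (X k) 0 (n % (2 * k)) * FreeGroup.of (lab k n) *
        (h' * sp (X k) 0 ((n + 1) % (2 * k)))⁻¹ ∈ K
      have h4 : lab k n = lab k (2 * k - 1) := by rw [← lab_mod k n, hn, lab_mod]
      rw [h2, hn, Nat.mod_eq_of_lt (show 2 * k - 1 < 2 * k by omega), h4]
      have h5 : sp (X k) 0 (2 * k) = sp (X k) 0 (2 * k - 1) * FreeGroup.of (lab k (2 * k - 1)) := by
        conv_lhs => rw [show 2 * k = (2 * k - 1) + 1 by omega]
        rw [sp, zero_add]; rfl
      have h6 : h' * nonorientableRelator k * h'⁻¹ ∈ K :=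
        Subgroup.subset_closure (Or.inr ⟨h', hT, rfl⟩)
      rw [← relator_eq, h5] at h6
      simpa [sp, mul_assoc] using h6
    · exact cE1 h' hh n hn
  have cloop : ∀ (E' : Set (B × Fin k × B)) h' hh, E ⊆ E' →
      (∀ n, (cB h' hh n, lab k n, cB h' hh (n + 1)) ∈ E') →
      LP E' v0 (h' * nonorientableRelator k * h'⁻¹) v0 := by
    intro E' h' hh hEE hc
    have h3 := GPath.ofSeq (src := fun e : B × Fin k × B => e.1) (tgt := fun e => e.2.2)
      (ℓ := fun e => FreeGroup.of e.2.1) (E := E')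
      (fun n => (cB h' hh n, lab k n, cB h' hh (n + 1))) (cB h' hh)
      0 (2 * k) (fun m _ _ => ⟨hc m, rfl, rfl⟩)
    rw [cper h' hh 0] at h3
    rw [← relator_eq]
    have h4 := (c0 h' hh).mono hEE
    exact (h4.trans h3).trans h4.symm
  have hh : h ∈ insert h T := Finset.mem_insert_self _ _
  refine ⟨B, ball_finite N, ⟨St.mk E v0 (fun v => ⟨_, conn v⟩) μ hμ hr ?_ ?_ (cB h hh) (2 * k - 1)
    (cper h hh) (cE1 h hh) ?_⟩⟩
  · intro w hw
    refine Subgroup.closure_mono ?_ (inK0 w hw)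
    apply Set.union_subset_union_right
    rintro _ ⟨h', hT, rfl⟩
    have hh' : h' ∈ insert h T := Finset.mem_insert_of_mem hT
    refine ⟨cB h' hh', 0, h', cper h' hh', cE2 h' hh' hT, c0 h' hh', ?_⟩
    simp only [relator_eq]
  · by_contra hcon
    push Not at hcon
    exact hT (eq_top_iff.2 fun w _ => inK0 w (hcon w))
  · intro w
    let E' := insert (cB h hh (2 * k - 1), lab k (2 * k - 1), cB h hh (2 * k - 1 + 1)) E
    have hEE : E ⊆ E' := Set.subset_insert _ _
    let L := GPath.loops (fun e : B × Fin k × B => e.1) (fun e => e.2.2)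
        (fun e => FreeGroup.of e.2.1) E' v0
    have hL : KK μ (insert h (T : Set _)) ≤ L := by
      refine (Subgroup.closure_le _).2 ?_
      rintro _ (⟨x, rfl⟩ | ⟨h', (rfl | hT), rfl⟩)
      · exact (hr x).mono hEE
      · refine cloop E' h' hh hEE (fun n => ?_)
        by_cases hn : n % (2 * k) = (2 * k - 1) % (2 * k)
        · left
          rw [per_mod (cper h' hh) hn, per_succ (cper h' hh) hn, per_mod (lab_periodic k) hn]
        · exact Or.inr (cE1 h' hh n hn)
      · have hh' : h' ∈ insert h T := Finset.mem_insert_of_mem hT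
        exact cloop E' h' hh' hEE (fun n => hEE (cE2 h' hh' hT n))
    exact hL (hT' ▸ Subgroup.mem_top w)

theorem goal (hφ : Function.Surjective φ) : Goal φ := by
  choose f hf using fun i : Fin k => rho_surj k (φ (FreeGroup.of i))
  let μ : FreeGroup (Fin k) →* FreeGroup (Fin k) := FreeGroup.lift f
  have hμ : ∀ x, standardRho k (μ x) = φ x := by
    have : (standardRho k).comp μ = φ := by
      ext i
      simp [μ, hf]
    exact fun x => DFunLike.congr_fun this x
  obtain ⟨T, hT⟩ := exists_finset_top hφ μ hμ
  rcases exists_minimal_conj μ hμ T hT with h | ⟨T, h, h1, h2⟩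
  · exact h
  · obtain ⟨V, _, ⟨S⟩⟩ := init_state μ hμ T h h1 h2
    exact St.goal hφ _ V inferInstance le_rfl S

end initial

end NSG

theorem epi_rank_k_nonorientable_nielsen_equivalent_standard (k : ℕ) (hk : 1 ≤ k)
    (φ : FreeGroup (Fin k) →* NonorientableSurfaceGroup k) (hφ : Function.Surjective φ) :
    ∃ α : FreeGroup (Fin k) ≃* FreeGroup (Fin k),
      φ.comp α.toMonoidHom = standardRho k := by
  have : NeZero k := ⟨by omega⟩
  obtain ⟨μ, hs, hμ⟩ := NSG.goal hφ
  let β : FreeGroup (Fin k) ≃* FreeGroup (Fin k) := MulEquiv.ofBijective μ ⟨NSG.hopf μ hs, hs⟩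
  refine ⟨β.symm, MonoidHom.ext fun y => ?_⟩
  have h1 : μ (β.symm y) = y := β.apply_symm_apply y
  show φ (β.symm y) = standardRho k y
  rw [← hμ, h1]
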